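/- (Lemma 3.1: pointwise bounds away from the Lagrangian origin) Given h ∈ (0,M₀) and T > 0, there exists a constant C = C(T,h) > 0, independent of ε, such that every smooth approximate solution satisfies: C⁻¹ ≤ ρ(t,r) ≤ C for all t ∈ [0,T] and all r ∈ [r_h(t), R], and ∫_0^t ‖θ(τ,·)‖_{h,∞} dτ ≤ C for all t ∈ [0,T]. -/

import Mathlib

noncomputable section
open MeasureTheory Set

/-- `Ψ(s) = s − log s − 1`. -/
def Psi (s : ℝ) : ℝ := s - Real.log s - 1

/-- The viscous dissipation `Q = ν(u_r + u/r)² − (2μ/r)·(u²)_r` with `ν = λ + 2μ`. -/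
def Qvisc (μ lam u ur r : ℝ) : ℝ :=
  (lam + 2 * μ) * (ur + u / r) ^ 2 - 2 * μ / r * (2 * u * ur)

/-- A smooth approximate solution of the spherically symmetric compressible Navier–Stokes
equations on the annulus `[ε,R]` over the time interval `[0,T]`, with viscosity constants
`μ, λ`, heat conductivity `κ`, gas constant `K`, data constants `C₀` (initial bounds),
`M₀` (total mass) and `C_f` (force bounds).  The fields `ρt, ρr, ut, ur, urr, θt, θr, θrr`
are the partial derivatives of the density `ρ`, velocity `u` and temperature `θ`. -/
structure ApproxSol (μ lam κ K ε R T C₀ M₀ Cf : ℝ) where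
  ρ : ℝ → ℝ → ℝ
  u : ℝ → ℝ → ℝ
  θ : ℝ → ℝ → ℝ
  f : ℝ → ℝ → ℝ
  ρt : ℝ → ℝ → ℝ
  ρr : ℝ → ℝ → ℝ
  ut : ℝ → ℝ → ℝ
  ur : ℝ → ℝ → ℝ
  urr : ℝ → ℝ → ℝ
  θt : ℝ → ℝ → ℝ
  θr : ℝ → ℝ → ℝ
  θrr : ℝ → ℝ → ℝ
  smooth_ρ : ContDiffOn ℝ (⊤ : ℕ∞) (Function.uncurry ρ) (Icc 0 T ×ˢ Icc ε R)
  smooth_u : ContDiffOn ℝ (⊤ : ℕ∞) (Function.uncurry u) (Icc 0 T ×ˢ Icc ε R)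
  smooth_θ : ContDiffOn ℝ (⊤ : ℕ∞) (Function.uncurry θ) (Icc 0 T ×ˢ Icc ε R)
  smooth_f : ContDiffOn ℝ (⊤ : ℕ∞) (Function.uncurry f) (Icc 0 T ×ˢ Icc ε R)
  hρt : ∀ t ∈ Icc (0:ℝ) T, ∀ r ∈ Icc ε R, HasDerivAt (fun s => ρ s r) (ρt t r) t
  hρr : ∀ t ∈ Icc (0:ℝ) T, ∀ r ∈ Icc ε R, HasDerivAt (fun x => ρ t x) (ρr t r) r
  hut : ∀ t ∈ Icc (0:ℝ) T, ∀ r ∈ Icc ε R, HasDerivAt (fun s => u s r) (ut t r) t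
  hur : ∀ t ∈ Icc (0:ℝ) T, ∀ r ∈ Icc ε R, HasDerivAt (fun x => u t x) (ur t r) r
  hurr : ∀ t ∈ Icc (0:ℝ) T, ∀ r ∈ Icc ε R, HasDerivAt (fun x => ur t x) (urr t r) r
  hθt : ∀ t ∈ Icc (0:ℝ) T, ∀ r ∈ Icc ε R, HasDerivAt (fun s => θ s r) (θt t r) t
  hθr : ∀ t ∈ Icc (0:ℝ) T, ∀ r ∈ Icc ε R, HasDerivAt (fun x => θ t x) (θr t r) r
  hθrr : ∀ t ∈ Icc (0:ℝ) T, ∀ r ∈ Icc ε R, HasDerivAt (fun x => θr t x) (θrr t r) r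
  ρ_pos : ∀ t ∈ Icc (0:ℝ) T, ∀ r ∈ Icc ε R, 0 < ρ t r
  θ_pos : ∀ t ∈ Icc (0:ℝ) T, ∀ r ∈ Icc ε R, 0 < θ t r
  /-- mass equation `ρ_t + (ρu)_r + ρu/r = 0` -/
  mass_eq : ∀ t ∈ Icc (0:ℝ) T, ∀ r ∈ Icc ε R,
    ρt t r + (ρr t r * u t r + ρ t r * ur t r) + ρ t r * u t r / r = 0
  /-- momentum equation `(ρu)_t + (ρu²)_r + ρu²/r + P_r − ν(u_r + u/r)_r = ρf`, `P = Kρθ` -/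
  momentum_eq : ∀ t ∈ Icc (0:ℝ) T, ∀ r ∈ Icc ε R,
    (ρt t r * u t r + ρ t r * ut t r)
      + (ρr t r * (u t r) ^ 2 + 2 * ρ t r * u t r * ur t r)
      + ρ t r * (u t r) ^ 2 / r
      + K * (ρr t r * θ t r + ρ t r * θr t r)
      - (lam + 2 * μ) * (urr t r + ur t r / r - u t r / r ^ 2)
    = ρ t r * f t r
  /-- energy equation `(ρθ)_t + (ρuθ)_r + ρuθ/r − κ(θ_rr + θ_r/r) + P(u_r + u/r) = Q` -/
  energy_eq : ∀ t ∈ Icc (0:ℝ) T, ∀ r ∈ Icc ε R,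
    (ρt t r * θ t r + ρ t r * θt t r)
      + (ρr t r * u t r * θ t r + ρ t r * ur t r * θ t r + ρ t r * u t r * θr t r)
      + ρ t r * u t r * θ t r / r
      - κ * (θrr t r + θr t r / r)
      + K * ρ t r * θ t r * (ur t r + u t r / r)
    = Qvisc μ lam (u t r) (ur t r) r
  bc_u : ∀ t ∈ Icc (0:ℝ) T, u t ε = 0 ∧ u t R = 0
  bc_θ : ∀ t ∈ Icc (0:ℝ) T, θr t ε = 0 ∧ θr t R = 0
  init_ρ : ∀ r ∈ Icc ε R, C₀⁻¹ ≤ ρ 0 r ∧ ρ 0 r ≤ C₀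
  init_θ : ∀ r ∈ Icc ε R, C₀⁻¹ ≤ θ 0 r
  init_entropy :
    (∫ r in ε..R, ρ 0 r * (K * Psi (1 / ρ 0 r) + Psi (θ 0 r) + (u 0 r) ^ 2 / 2) * r) ≤ C₀
  init_mass : (∫ r in ε..R, ρ 0 r * r) = M₀
  force_int : (∫ t in (0:ℝ)..T, (⨆ r : Icc ε R, |f t (r : ℝ)|)) ≤ Cf
  force_sq : ∀ t ∈ Icc (0:ℝ) T, (∫ r in ε..R, (f t r) ^ 2 * r) ≤ Cf

section Analysis

open Function Filter Topology Interval

variable {a b c d : ℝ}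

lemma exists_continuous_extension₂ (hab : a ≤ b) (hcd : c ≤ d) {g : ℝ → ℝ → ℝ}
    (hg : ContinuousOn (uncurry g) (Icc a b ×ˢ Icc c d)) :
    ∃ G : ℝ → ℝ → ℝ, Continuous (uncurry G) ∧ ∀ t ∈ Icc a b, ∀ r ∈ Icc c d, G t r = g t r := by
  refine ⟨fun t r => g (projIcc a b hab t) (projIcc c d hcd r), ?_, fun t ht r hr => ?_⟩
  · have h : Continuous fun p : ℝ × ℝ =>
        ((projIcc a b hab p.1 : ℝ), (projIcc c d hcd p.2 : ℝ)) := by fun_prop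
    exact hg.comp_continuous h fun p => ⟨Subtype.coe_prop _, Subtype.coe_prop _⟩
  · simp [projIcc_of_mem hab ht, projIcc_of_mem hcd hr]

lemma exists_continuous_extension (hab : a ≤ b) {g : ℝ → ℝ} (hg : ContinuousOn g (Icc a b)) :
    ∃ G : ℝ → ℝ, Continuous G ∧ ∀ t ∈ Icc a b, G t = g t := by
  refine ⟨fun t => g (projIcc a b hab t), ?_, fun t ht => ?_⟩
  · have h : Continuous fun p : ℝ => (projIcc a b hab p : ℝ) := by fun_prop
    exact hg.comp_continuous h fun p => Subtype.coe_prop _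
  · simp [projIcc_of_mem hab ht]

lemma continuousOn_slice_right {g : ℝ → ℝ → ℝ}
    (hg : ContinuousOn (uncurry g) (Icc a b ×ˢ Icc c d)) {t : ℝ} (ht : t ∈ Icc a b) :
    ContinuousOn (g t) (Icc c d) :=
  hg.comp (f := fun r => (t, r)) (by fun_prop) fun _ hr => ⟨ht, hr⟩

lemma continuousOn_slice_left {g : ℝ → ℝ → ℝ}
    (hg : ContinuousOn (uncurry g) (Icc a b ×ˢ Icc c d)) {r : ℝ} (hr : r ∈ Icc c d) :
    ContinuousOn (fun t => g t r) (Icc a b) :=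
  hg.comp (f := fun t => (t, r)) (by fun_prop) fun _ ht => ⟨ht, hr⟩

lemma continuousOn_comp_path {g : ℝ → ℝ → ℝ}
    (hg : ContinuousOn (uncurry g) (Icc a b ×ˢ Icc c d)) {x : ℝ → ℝ}
    (hx : ContinuousOn x (Icc a b)) (hxm : ∀ t ∈ Icc a b, x t ∈ Icc c d) :
    ContinuousOn (fun t => g t (x t)) (Icc a b) :=
  hg.comp (f := fun t => (t, x t)) (by fun_prop) fun t ht => ⟨ht, hxm t ht⟩

lemma ContinuousOn.intervalIntegrable_sub {g : ℝ → ℝ} (hg : ContinuousOn g (Icc a b)) {x y : ℝ}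
    (hx : x ∈ Icc a b) (hy : y ∈ Icc a b) : IntervalIntegrable g volume x y :=
  (hg.mono (uIcc_subset_Icc hx hy)).intervalIntegrable

lemma hasDerivAt_primitive {g : ℝ → ℝ} (hg : ContinuousOn g (Icc a b)) {t : ℝ}
    (ht : t ∈ Ioo a b) : HasDerivAt (fun t => ∫ x in a..t, g x) (g t) t := by
  obtain ⟨G, hG, hGg⟩ := exists_continuous_extension (ht.1.trans ht.2).le hg
  have h := (hG.integral_hasStrictDerivAt a t).hasDerivAt
  rw [hGg t (Ioo_subset_Icc_self ht)] at h
  refine h.congr_of_eventuallyEq ?_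
  filter_upwards [Ioo_mem_nhds ht.1 ht.2] with s hs
  refine intervalIntegral.integral_congr fun x hx => (hGg x ?_).symm
  exact uIcc_subset_Icc (left_mem_Icc.2 (hs.1.trans hs.2).le) (Ioo_subset_Icc_self hs) hx

lemma continuousOn_primitive_Icc {g : ℝ → ℝ} (hab : a ≤ b) (hg : ContinuousOn g (Icc a b)) :
    ContinuousOn (fun t => ∫ x in a..t, g x) (Icc a b) := by
  have := intervalIntegral.continuousOn_primitive_interval (f := g) (a := a) (b := b) (μ := volume)
  rw [uIcc_of_le hab] at this
  exact this hg.integrableOn_Icc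

lemma continuousOn_integral_upper (hab : a ≤ b) (hcd : c ≤ d) {g : ℝ → ℝ → ℝ}
    (hg : ContinuousOn (uncurry g) (Icc a b ×ˢ Icc c d)) :
    ContinuousOn (uncurry fun t y => ∫ r in y..d, g t r) (Icc a b ×ˢ Icc c d) := by
  obtain ⟨G, hG, hGg⟩ := exists_continuous_extension₂ hab hcd hg
  have h : Continuous fun p : ℝ × ℝ => ∫ r in d..p.2, G p.1 r :=
    intervalIntegral.continuous_parametric_primitive_of_continuous (f := G) hG
  refine h.neg.continuousOn.congr fun p hp => ?_
  simp only [uncurry]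
  rw [intervalIntegral.integral_symm, Pi.neg_apply, neg_inj]
  refine intervalIntegral.integral_congr fun r hr => (hGg _ hp.1 r ?_).symm
  exact uIcc_subset_Icc (right_mem_Icc.2 hcd) hp.2 hr

lemma continuousOn_integral_const (hab : a ≤ b) (hcd : c ≤ d) {g : ℝ → ℝ → ℝ}
    (hg : ContinuousOn (uncurry g) (Icc a b ×ˢ Icc c d)) :
    ContinuousOn (fun t => ∫ r in c..d, g t r) (Icc a b) :=
  continuousOn_slice_left (continuousOn_integral_upper hab hcd hg) (left_mem_Icc.2 hcd)

lemma hasDerivAt_integral_param {g gt : ℝ → ℝ → ℝ}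
    (hg : ContinuousOn (uncurry g) (Icc a b ×ˢ Icc c d))
    (hgt : ContinuousOn (uncurry gt) (Icc a b ×ˢ Icc c d))
    (hd : ∀ t ∈ Ioo a b, ∀ r ∈ Icc c d, HasDerivAt (fun s => g s r) (gt t r) t)
    {t : ℝ} (ht : t ∈ Ioo a b) {y z : ℝ} (hy : y ∈ Icc c d) (hz : z ∈ Icc c d) :
    HasDerivAt (fun s => ∫ r in y..z, g s r) (∫ r in y..z, gt t r) t := by
  obtain ⟨B, hB⟩ := (isCompact_Icc.prod isCompact_Icc).exists_bound_of_continuousOn hgt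
  have hsub : Ι y z ⊆ Icc c d := uIoc_subset_uIcc.trans (uIcc_subset_Icc hy hz)
  refine (intervalIntegral.hasDerivAt_integral_of_dominated_loc_of_deriv_le (bound := fun _ => B)
    (Ioo_mem_nhds ht.1 ht.2) ?_ ?_ ?_ ?_ ?_ ?_).2
  · filter_upwards [Ioo_mem_nhds ht.1 ht.2] with s hs
    exact ((continuousOn_slice_right hg (Ioo_subset_Icc_self hs)).mono hsub).aestronglyMeasurable
      measurableSet_uIoc
  · exact (continuousOn_slice_right hg (Ioo_subset_Icc_self ht)).intervalIntegrable_sub hy hz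
  · exact ((continuousOn_slice_right hgt (Ioo_subset_Icc_self ht)).mono hsub).aestronglyMeasurable
      measurableSet_uIoc
  · exact ae_of_all _ fun r hr s hs => hB (s, r) ⟨Ioo_subset_Icc_self hs, hsub hr⟩
  · exact intervalIntegrable_const
  · exact ae_of_all _ fun r hr s hs => hd s hs r (hsub hr)

/-- Chain rule along a path for a function of two variables with continuous partials. -/
lemma hasDerivAt_along {f ft fr : ℝ → ℝ → ℝ}
    (hft : ContinuousOn (uncurry ft) (Icc a b ×ˢ Icc c d))
    (hfr : ContinuousOn (uncurry fr) (Icc a b ×ˢ Icc c d))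
    (hdt : ∀ t ∈ Ioo a b, ∀ r ∈ Ioo c d, HasDerivAt (fun s => f s r) (ft t r) t)
    (hdr : ∀ t ∈ Ioo a b, ∀ r ∈ Ioo c d, HasDerivAt (f t) (fr t r) r)
    {t : ℝ} (ht : t ∈ Ioo a b) {x : ℝ → ℝ} {x' : ℝ} (hx : x t ∈ Ioo c d)
    (hxd : HasDerivAt x x' t) :
    HasDerivAt (fun s => f s (x s)) (ft t (x t) + fr t (x t) * x') t := by
  have hn : Ioo a b ×ˢ Ioo c d ∈ 𝓝 (t, x t) :=
    prod_mem_nhds (Ioo_mem_nhds ht.1 ht.2) (Ioo_mem_nhds hx.1 hx.2)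
  have hn' : Icc a b ×ˢ Icc c d ∈ 𝓝 (t, x t) :=
    mem_of_superset hn (prod_mono Ioo_subset_Icc_self Ioo_subset_Icc_self)
  have key := hasStrictFDerivAt_uncurry_coprod (𝕜 := ℝ) (u := (t, x t)) (f := f)
    (f₁ := fun s r => ContinuousLinearMap.toSpanSingleton ℝ (ft s r))
    (f₂ := fun s r => ContinuousLinearMap.toSpanSingleton ℝ (fr s r))
    (by filter_upwards [hn] with p hp using (hdt p.1 hp.1 p.2 hp.2).hasFDerivAt)
    (by filter_upwards [hn] with p hp using (hdr p.1 hp.1 p.2 hp.2).hasFDerivAt)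
    ((ContinuousLinearMap.toSpanSingletonCLE (𝕜 := ℝ) (E := ℝ)).continuous.continuousAt.comp
      (hft.continuousAt hn'))
    ((ContinuousLinearMap.toSpanSingletonCLE (𝕜 := ℝ) (E := ℝ)).continuous.continuousAt.comp
      (hfr.continuousAt hn'))
  have := key.hasFDerivAt.comp_hasDerivAt t ((hasDerivAt_id t).prodMk hxd)
  refine HasDerivAt.congr_deriv (f := fun s => f s (x s)) this ?_
  simp [HasUncurry.uncurry, mul_comm]

/-- A path along which a primitive is constant moves with the quotient of the partials. -/
lemma hasDerivAt_implicit (hcd : c ≤ d) {k : ℝ → ℝ → ℝ} {x : ℝ → ℝ} {h m' : ℝ}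
    (hk : ContinuousOn (uncurry k) (Icc a b ×ˢ Icc c d))
    (hkpos : ∀ t ∈ Icc a b, ∀ r ∈ Icc c d, 0 < k t r)
    (hxm : ∀ t ∈ Icc a b, x t ∈ Icc c d) (hxc : ContinuousOn x (Icc a b))
    (hxh : ∀ t ∈ Icc a b, ∫ r in c..x t, k t r = h) {t : ℝ} (ht : t ∈ Ioo a b)
    (hm : HasDerivAt (fun s => ∫ r in c..x t, k s r) m' t) :
    HasDerivAt x (-m' / k t (x t)) t := by
  have htI := Ioo_subset_Icc_self ht
  obtain ⟨G, hG, hGk⟩ := exists_continuous_extension₂ (ht.1.trans ht.2).le hcd hk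
  set A : ℝ → ℝ := fun s => ∫ σ in (0:ℝ)..1, G s (x t + (x s - x t) * σ) with hA
  have hxt : ContinuousAt x t := hxc.continuousAt (Icc_mem_nhds ht.1 ht.2)
  have hAc : ContinuousAt A t := by
    have h1 : Continuous fun p : ℝ × ℝ => ∫ σ in (0:ℝ)..1, G p.1 (x t + (p.2 - x t) * σ) := by
      apply intervalIntegral.continuous_parametric_intervalIntegral_of_continuous'
        (f := fun (p : ℝ × ℝ) (σ : ℝ) => G p.1 (x t + (p.2 - x t) * σ))
      exact hG.comp (by fun_prop : Continuous fun q : (ℝ × ℝ) × ℝ =>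
        (q.1.1, x t + (q.1.2 - x t) * q.2))
    exact h1.continuousAt.comp (f := fun s => (s, x s)) (by fun_prop)
  have hAt : A t = k t (x t) := by
    simp [hA, hGk t htI (x t) (hxm t htI)]
  have hpos : 0 < k t (x t) := hkpos t htI _ (hxm t htI)
  have hAne : ∀ᶠ s in 𝓝[≠] t, A s ≠ 0 := by
    refine (hAc.eventually_ne ?_).filter_mono nhdsWithin_le_nhds
    rw [hAt]; exact hpos.ne'
  rw [hasDerivAt_iff_tendsto_slope] at hm ⊢
  have hlim := (hm.neg.div (hAc.tendsto.mono_left nhdsWithin_le_nhds) (by rw [hAt]; exact hpos.ne'))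
  rw [hAt] at hlim
  refine hlim.congr' ?_
  filter_upwards [hAne, mem_nhdsWithin_of_mem_nhds (Ioo_mem_nhds ht.1 ht.2)] with s hs hsI
  have hsI' := Ioo_subset_Icc_self hsI
  have hkey : (x s - x t) * A s = -((∫ r in c..x t, k s r) - ∫ r in c..x t, k t r) := by
    have h1 := intervalIntegral.smul_integral_comp_add_mul (a := 0) (b := 1) (G s) (x s - x t) (x t)
    simp only [mul_zero, add_zero, mul_one, smul_eq_mul, add_sub_cancel] at h1
    have h2 : (∫ r in x t..x s, G s r) = ∫ r in x t..x s, k s r :=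
      intervalIntegral.integral_congr fun r hr =>
        hGk s hsI' r (uIcc_subset_Icc (hxm t htI) (hxm s hsI') hr)
    have hks := continuousOn_slice_right hk hsI'
    have h3 := intervalIntegral.integral_add_adjacent_intervals
      (hks.intervalIntegrable_sub (left_mem_Icc.2 hcd) (hxm t htI))
      (hks.intervalIntegrable_sub (hxm t htI) (hxm s hsI'))
    rw [hxh s hsI'] at h3
    rw [hxh t htI, hA]
    dsimp only
    rw [h1, h2]
    linarith
  simp only [Pi.div_apply, slope_def_field]
  rw [div_eq_iff hs, div_mul_eq_mul_div, hkey, neg_div]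

lemma continuousOn_implicit (hab : a ≤ b) (hcd : c ≤ d) {k : ℝ → ℝ → ℝ} {x : ℝ → ℝ} {h : ℝ}
    (hk : ContinuousOn (uncurry k) (Icc a b ×ˢ Icc c d))
    (hkpos : ∀ t ∈ Icc a b, ∀ r ∈ Icc c d, 0 < k t r)
    (hxm : ∀ t ∈ Icc a b, x t ∈ Icc c d)
    (hxh : ∀ t ∈ Icc a b, ∫ r in c..x t, k t r = h) : ContinuousOn x (Icc a b) := by
  obtain ⟨p, hp, hmin⟩ := (isCompact_Icc.prod isCompact_Icc).exists_isMinOn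
    ⟨(a, c), left_mem_Icc.2 hab, left_mem_Icc.2 hcd⟩ hk
  set κ := uncurry k p
  have hκ : 0 < κ := hkpos _ hp.1 _ hp.2
  intro t ht
  have hlow : ∀ s ∈ Icc a b, ∀ y ∈ Icc c d, ∀ z ∈ Icc c d,
      κ * |z - y| ≤ |∫ r in y..z, k s r| := by
    intro s hs
    have hmono : ∀ y ∈ Icc c d, ∀ z ∈ Icc c d, y ≤ z → κ * |z - y| ≤ |∫ r in y..z, k s r| := by
      intro y hy z hz hyz
      have := intervalIntegral.integral_mono_on hyz (intervalIntegrable_const (c := κ))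
        ((continuousOn_slice_right hk hs).intervalIntegrable_sub hy hz)
        fun r hr => hmin (show (s, r) ∈ Icc a b ×ˢ Icc c d from
          ⟨hs, hy.1.trans hr.1, hr.2.trans hz.2⟩)
      rw [intervalIntegral.integral_const, smul_eq_mul] at this
      rw [abs_of_nonneg (sub_nonneg.2 hyz)]
      exact (by linarith : κ * (z - y) ≤ _).trans (le_abs_self _)
    intro y hy z hz
    rcases le_total y z with hyz | hyz
    · exact hmono y hy z hz hyz
    · rw [intervalIntegral.integral_symm, abs_neg, abs_sub_comm]
      exact hmono z hz y hy hyz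
  have hmc : ContinuousWithinAt (fun s => ∫ r in c..x t, k s r) (Icc a b) t := by
    have h1 : ContinuousOn (fun s => (∫ r in c..d, k s r) - ∫ r in x t..d, k s r) (Icc a b) :=
      (continuousOn_integral_const hab hcd hk).sub
        (continuousOn_slice_left (continuousOn_integral_upper hab hcd hk) (hxm t ht))
    refine (h1.congr fun s hs => ?_) t ht
    have hks := continuousOn_slice_right hk hs
    have := intervalIntegral.integral_add_adjacent_intervals
      (hks.intervalIntegrable_sub (left_mem_Icc.2 hcd) (hxm t ht))
      (hks.intervalIntegrable_sub (hxm t ht) (right_mem_Icc.2 hcd))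
    linarith
  have hlim : Tendsto (fun s => |h - ∫ r in c..x t, k s r| / κ) (𝓝[Icc a b] t) (𝓝 0) := by
    have := ((tendsto_const_nhds (x := h)).sub hmc.tendsto).abs.div_const κ
    simpa [hxh t ht] using this
  refine tendsto_iff_dist_tendsto_zero.2 (squeeze_zero' (Eventually.of_forall fun _ => dist_nonneg)
    ?_ hlim)
  filter_upwards [self_mem_nhdsWithin] with s hs
  rw [Real.dist_eq, le_div_iff₀ hκ, mul_comm]
  refine (hlow s hs _ (hxm t ht) _ (hxm s hs)).trans_eq ?_
  have hks := continuousOn_slice_right hk hs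
  have h3 := intervalIntegral.integral_add_adjacent_intervals
      (hks.intervalIntegrable_sub (left_mem_Icc.2 hcd) (hxm t ht))
      (hks.intervalIntegrable_sub (hxm t ht) (hxm s hs))
  rw [hxh s hs] at h3
  congr 1; linarith

lemma contDiffOn_partial_right (hab : a < b) (hcd : c < d) {g gr : ℝ → ℝ → ℝ}
    (hg : ContDiffOn ℝ (⊤ : ℕ∞) (uncurry g) (Icc a b ×ˢ Icc c d))
    (hd : ∀ t ∈ Icc a b, ∀ r ∈ Icc c d, HasDerivAt (fun x => g t x) (gr t r) r) :
    ContDiffOn ℝ (⊤ : ℕ∞) (uncurry gr) (Icc a b ×ˢ Icc c d) := by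
  have hu : UniqueDiffOn ℝ (Icc a b ×ˢ Icc c d) := (uniqueDiffOn_Icc hab).prod (uniqueDiffOn_Icc hcd)
  have h := (hg.fderivWithin hu (m := ((⊤ : ℕ∞) : WithTop ℕ∞)) (by simp)).clm_apply
    (contDiffOn_const (c := ((0:ℝ), (1:ℝ))))
  refine h.congr fun p hp => ?_
  have h1 := (hg.differentiableOn (by simp) p hp).hasFDerivWithinAt
  have h2 := h1.comp_hasDerivWithinAt (f := fun x => (p.1, x)) (s := Icc c d) p.2
    ((hasDerivWithinAt_const _ _ _).prodMk (hasDerivWithinAt_id _ _)) fun x hx => ⟨hp.1, hx⟩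
  exact (uniqueDiffOn_Icc hcd p.2 hp.2).eq_deriv _ (hd p.1 hp.1 p.2 hp.2).hasDerivWithinAt h2

lemma contDiffOn_partial_left (hab : a < b) (hcd : c < d) {g gt : ℝ → ℝ → ℝ}
    (hg : ContDiffOn ℝ (⊤ : ℕ∞) (uncurry g) (Icc a b ×ˢ Icc c d))
    (hd : ∀ t ∈ Icc a b, ∀ r ∈ Icc c d, HasDerivAt (fun x => g x r) (gt t r) t) :
    ContDiffOn ℝ (⊤ : ℕ∞) (uncurry gt) (Icc a b ×ˢ Icc c d) := by
  have hu : UniqueDiffOn ℝ (Icc a b ×ˢ Icc c d) := (uniqueDiffOn_Icc hab).prod (uniqueDiffOn_Icc hcd)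
  have h := (hg.fderivWithin hu (m := ((⊤ : ℕ∞) : WithTop ℕ∞)) (by simp)).clm_apply
    (contDiffOn_const (c := ((1:ℝ), (0:ℝ))))
  refine h.congr fun p hp => ?_
  have h1 := (hg.differentiableOn (by simp) p hp).hasFDerivWithinAt
  have h2 := h1.comp_hasDerivWithinAt (f := fun x => (x, p.2)) (s := Icc a b) p.1
    ((hasDerivWithinAt_id _ _).prodMk (hasDerivWithinAt_const _ _ _)) fun x hx => ⟨hx, hp.2⟩
  exact (uniqueDiffOn_Icc hab p.1 hp.1).eq_deriv _ (hd p.1 hp.1 p.2 hp.2).hasDerivWithinAt h2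

/-- Grönwall's inequality with a time-dependent coefficient. -/
lemma gronwall_le {T : ℝ} {y y' α : ℝ → ℝ} (hy : ContinuousOn y (Icc 0 T))
    (hα : ContinuousOn α (Icc 0 T)) (hd : ∀ t ∈ Ioo 0 T, HasDerivAt y (y' t) t)
    (hle : ∀ t ∈ Ioo 0 T, y' t ≤ α t * y t) {t : ℝ} (ht : t ∈ Icc 0 T) :
    y t ≤ y 0 * Real.exp (∫ τ in (0:ℝ)..t, α τ) := by
  have hT : 0 ≤ T := ht.1.trans ht.2
  have hder : ∀ s ∈ Ioo 0 T, HasDerivAt (fun s => y s * Real.exp (-∫ τ in (0:ℝ)..s, α τ))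
      (y' s * Real.exp (-∫ τ in (0:ℝ)..s, α τ)
        + y s * (Real.exp (-∫ τ in (0:ℝ)..s, α τ) * -α s)) s := fun s hs =>
    (hd s hs).mul (hasDerivAt_primitive hα hs).neg.exp
  have hanti : AntitoneOn (fun s => y s * Real.exp (-∫ τ in (0:ℝ)..s, α τ)) (Icc 0 T) := by
    refine antitoneOn_of_deriv_nonpos (convex_Icc 0 T)
      (hy.mul (continuousOn_primitive_Icc hT hα).neg.rexp) ?_ ?_
    · rw [interior_Icc]
      exact fun s hs => (hder s hs).differentiableAt.differentiableWithinAt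
    · rw [interior_Icc]
      intro s hs
      rw [(hder s hs).deriv]
      nlinarith [Real.exp_pos (-∫ τ in (0:ℝ)..s, α τ), hle s hs]
  have h := hanti (left_mem_Icc.2 hT) ht ht.1
  simp only [intervalIntegral.integral_same, neg_zero, Real.exp_zero, mul_one] at h
  rw [Real.exp_neg, ← div_eq_mul_inv, div_le_iff₀ (Real.exp_pos _)] at h
  exact h

lemma le_gronwall {T : ℝ} {y y' α : ℝ → ℝ} (hy : ContinuousOn y (Icc 0 T))
    (hα : ContinuousOn α (Icc 0 T)) (hd : ∀ t ∈ Ioo 0 T, HasDerivAt y (y' t) t)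
    (hle : ∀ t ∈ Ioo 0 T, -α t * y t ≤ y' t) {t : ℝ} (ht : t ∈ Icc 0 T) :
    y 0 * Real.exp (-∫ τ in (0:ℝ)..t, α τ) ≤ y t := by
  have := gronwall_le (y := fun t => -y t) (y' := fun t => -y' t) (α := fun t => -α t) hy.neg hα.neg
    (fun t ht => (hd t ht).neg) (fun t ht => by linarith [hle t ht]) ht
  rw [intervalIntegral.integral_neg] at this
  linarith

/-- The integrated form of a differential inequality. -/
lemma sub_le_integral_of_deriv_le {T : ℝ} {y y' α : ℝ → ℝ} (hy : ContinuousOn y (Icc 0 T))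
    (hα : ContinuousOn α (Icc 0 T)) (hd : ∀ t ∈ Ioo 0 T, HasDerivAt y (y' t) t)
    (hle : ∀ t ∈ Ioo 0 T, y' t ≤ α t) {t : ℝ} (ht : t ∈ Icc 0 T) :
    y t ≤ y 0 + ∫ τ in (0:ℝ)..t, α τ := by
  have hT : 0 ≤ T := ht.1.trans ht.2
  have hder : ∀ s ∈ Ioo 0 T, HasDerivAt (fun s => y s - ∫ τ in (0:ℝ)..s, α τ) (y' s - α s) s :=
    fun s hs => (hd s hs).sub (hasDerivAt_primitive hα hs)
  have hanti : AntitoneOn (fun s => y s - ∫ τ in (0:ℝ)..s, α τ) (Icc 0 T) := by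
    refine antitoneOn_of_deriv_nonpos (convex_Icc 0 T)
      (hy.sub (continuousOn_primitive_Icc hT hα)) ?_ ?_
    · rw [interior_Icc]
      exact fun s hs => (hder s hs).differentiableAt.differentiableWithinAt
    · rw [interior_Icc]
      intro s hs
      rw [(hder s hs).deriv]
      linarith [hle s hs]
  have h := hanti (left_mem_Icc.2 hT) ht ht.1
  simp only [intervalIntegral.integral_same, sub_zero] at h
  linarith

lemma gronwall_integral {T N₀ : ℝ} {y α : ℝ → ℝ} (hy : ContinuousOn y (Icc 0 T))
    (hα : ContinuousOn α (Icc 0 T)) (hα0 : ∀ t ∈ Icc 0 T, 0 ≤ α t)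
    (hle : ∀ t ∈ Icc 0 T, y t ≤ N₀ + ∫ τ in (0:ℝ)..t, α τ * y τ) {t : ℝ} (ht : t ∈ Icc 0 T) :
    y t ≤ N₀ * Real.exp (∫ τ in (0:ℝ)..t, α τ) := by
  have hT : 0 ≤ T := ht.1.trans ht.2
  have := gronwall_le (y := fun t => N₀ + ∫ τ in (0:ℝ)..t, α τ * y τ)
    (y' := fun t => α t * y t) (α := α)
    (continuousOn_const.add (continuousOn_primitive_Icc hT (hα.mul hy))) hα
    (fun t ht => (hasDerivAt_primitive (hα.mul hy) ht).const_add N₀)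
    (fun t ht => mul_le_mul_of_nonneg_left (hle t (Ioo_subset_Icc_self ht))
      (hα0 t (Ioo_subset_Icc_self ht))) ht
  simpa using (hle t ht).trans this

/-- The supremum over a moving interval `[x(t), d]` is continuous. -/
lemma continuousOn_iSup_Icc (hab : a ≤ b) (hcd : c ≤ d) {g : ℝ → ℝ → ℝ} {x : ℝ → ℝ}
    (hg : ContinuousOn (uncurry g) (Icc a b ×ˢ Icc c d))
    (hxm : ∀ t ∈ Icc a b, x t ∈ Icc c d) (hx : ContinuousOn x (Icc a b)) :
    ContinuousOn (fun t => ⨆ r : Icc (x t) d, g t r) (Icc a b) := by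
  obtain ⟨G, hG, hGg⟩ := exists_continuous_extension₂ hab hcd hg
  obtain ⟨X, hX, hXx⟩ := exists_continuous_extension hab hx
  have h : Continuous fun t => sSup ((fun σ => G t (X t + σ * (d - X t))) '' Icc (0:ℝ) 1) := by
    refine isCompact_Icc.continuous_sSup (f := fun t σ => G t (X t + σ * (d - X t))) ?_
    exact hG.comp (by fun_prop : Continuous fun q : ℝ × ℝ => (q.1, X q.1 + q.2 * (d - X q.1)))
  refine h.continuousOn.congr fun t ht => ?_
  have hxt := hxm t ht
  dsimp only
  rw [iSup, hXx t ht]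
  congr 1
  ext v
  simp only [mem_range, Subtype.exists, mem_image]
  constructor
  · rintro ⟨r, hr, rfl⟩
    rcases hxt.2.eq_or_lt with he | hl
    · refine ⟨0, by simp, ?_⟩
      have : r = x t := le_antisymm (hr.2.trans he.ge) hr.1
      rw [zero_mul, add_zero, hGg t ht _ hxt, this]
    · have hp : 0 < d - x t := sub_pos.2 hl
      refine ⟨(r - x t) / (d - x t), ⟨div_nonneg (sub_nonneg.2 hr.1) hp.le,
        (div_le_one hp).2 (by linarith [hr.2])⟩, ?_⟩
      rw [div_mul_cancel₀ _ hp.ne', add_sub_cancel, hGg t ht r ⟨hxt.1.trans hr.1, hr.2⟩]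
  · rintro ⟨σ, hσ, rfl⟩
    have h1 : x t + σ * (d - x t) ∈ Icc (x t) d :=
      ⟨by nlinarith [hσ.1, hxt.2], by nlinarith [hσ.2, hxt.2]⟩
    exact ⟨_, h1, (hGg t ht _ ⟨hxt.1.trans h1.1, h1.2⟩).symm⟩

lemma bddAbove_range_Icc {g : ℝ → ℝ} {x y : ℝ} (hg : ContinuousOn g (Icc x y)) :
    BddAbove (range fun r : Icc x y => g r) := by
  obtain ⟨B, hB⟩ := isCompact_Icc.bddAbove_image hg
  exact ⟨B, by rintro _ ⟨r, rfl⟩; exact hB ⟨r, r.2, rfl⟩⟩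

end Analysis
namespace ApproxSol

open Function

section Continuity

variable {μ lam κ K ε R T C₀ M₀ Cf : ℝ} (s : ApproxSol μ lam κ K ε R T C₀ M₀ Cf)
include s

lemma continuousOn_ρ : ContinuousOn (fun p : ℝ × ℝ => s.ρ p.1 p.2) (Icc 0 T ×ˢ Icc ε R) :=
  s.smooth_ρ.continuousOn

lemma continuousOn_u : ContinuousOn (fun p : ℝ × ℝ => s.u p.1 p.2) (Icc 0 T ×ˢ Icc ε R) :=
  s.smooth_u.continuousOn

lemma continuousOn_θ : ContinuousOn (fun p : ℝ × ℝ => s.θ p.1 p.2) (Icc 0 T ×ˢ Icc ε R) :=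
  s.smooth_θ.continuousOn

lemma continuousOn_f : ContinuousOn (fun p : ℝ × ℝ => s.f p.1 p.2) (Icc 0 T ×ˢ Icc ε R) :=
  s.smooth_f.continuousOn

lemma continuousOn_massDensity :
    ContinuousOn (uncurry fun t r => s.ρ t r * r) (Icc 0 T ×ˢ Icc ε R) :=
  s.continuousOn_ρ.mul continuous_snd.continuousOn

variable (hT : 0 < T) (hεR : ε < R)
include hT hεR

lemma continuousOn_ρt : ContinuousOn (fun p : ℝ × ℝ => s.ρt p.1 p.2) (Icc 0 T ×ˢ Icc ε R) :=
  (contDiffOn_partial_left hT hεR s.smooth_ρ s.hρt).continuousOn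

lemma continuousOn_ρr : ContinuousOn (fun p : ℝ × ℝ => s.ρr p.1 p.2) (Icc 0 T ×ˢ Icc ε R) :=
  (contDiffOn_partial_right hT hεR s.smooth_ρ s.hρr).continuousOn

lemma continuousOn_ut : ContinuousOn (fun p : ℝ × ℝ => s.ut p.1 p.2) (Icc 0 T ×ˢ Icc ε R) :=
  (contDiffOn_partial_left hT hεR s.smooth_u s.hut).continuousOn

lemma continuousOn_ur : ContinuousOn (fun p : ℝ × ℝ => s.ur p.1 p.2) (Icc 0 T ×ˢ Icc ε R) :=
  (contDiffOn_partial_right hT hεR s.smooth_u s.hur).continuousOn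

lemma continuousOn_θt : ContinuousOn (fun p : ℝ × ℝ => s.θt p.1 p.2) (Icc 0 T ×ˢ Icc ε R) :=
  (contDiffOn_partial_left hT hεR s.smooth_θ s.hθt).continuousOn

lemma continuousOn_θr : ContinuousOn (fun p : ℝ × ℝ => s.θr p.1 p.2) (Icc 0 T ×ˢ Icc ε R) :=
  (contDiffOn_partial_right hT hεR s.smooth_θ s.hθr).continuousOn

end Continuity

section Mass

variable {μ lam κ K ε R T C₀ M₀ Cf : ℝ} (s : ApproxSol μ lam κ K ε R T C₀ M₀ Cf)
  (hT : 0 < T) (hε : 0 < ε) (hεR : ε < R)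
include hT hε hεR

/-- The partial mass changes at the rate given by the flux through its outer boundary. -/
lemma hasDerivAt_mass {t : ℝ} (ht : t ∈ Ioo 0 T) {y : ℝ} (hy : y ∈ Icc ε R) :
    HasDerivAt (fun τ => ∫ r in ε..y, s.ρ τ r * r) (-(s.ρ t y * s.u t y * y)) t := by
  have htI := Ioo_subset_Icc_self ht
  have hct : ContinuousOn (uncurry fun t r => s.ρt t r * r) (Icc 0 T ×ˢ Icc ε R) :=
    (s.continuousOn_ρt hT hεR).mul continuous_snd.continuousOn
  refine (hasDerivAt_integral_param s.continuousOn_massDensity hct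
    (fun τ hτ r hr => (s.hρt τ (Ioo_subset_Icc_self hτ) r hr).mul_const r) ht
    (left_mem_Icc.2 hεR.le) hy).congr_deriv ?_
  have h := intervalIntegral.integral_eq_sub_of_hasDerivAt
    (f := fun r => -(s.ρ t r * s.u t r * r)) (f' := fun r => s.ρt t r * r) (a := ε) (b := y)
    (fun r hr => ?_) ((continuousOn_slice_right hct htI).intervalIntegrable_sub
      (left_mem_Icc.2 hεR.le) hy)
  · rw [h, (s.bc_u t htI).1]; simp
  · have hr' := uIcc_subset_Icc (left_mem_Icc.2 hεR.le) hy hr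
    refine (((s.hρr t htI r hr').mul (s.hur t htI r hr')).mul (hasDerivAt_id r)).neg.congr_deriv ?_
    have hr0 : r ≠ 0 := (hε.trans_le hr'.1).ne'
    have hm := s.mass_eq t htI r hr'
    have : s.ρt t r * r = -((s.ρr t r * s.u t r + s.ρ t r * s.ur t r) * r + s.ρ t r * s.u t r) := by
      field_simp at hm
      linear_combination hm
    simp [this]

lemma integral_mass {t : ℝ} (ht : t ∈ Icc 0 T) : ∫ r in ε..R, s.ρ t r * r = M₀ := by
  have hc := continuousOn_integral_const hT.le hεR.le s.continuousOn_massDensity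
  have hd : ∀ τ ∈ Ioo 0 T, HasDerivAt (fun τ => ∫ r in ε..R, s.ρ τ r * r) 0 τ := fun τ hτ => by
    simpa [(s.bc_u τ (Ioo_subset_Icc_self hτ)).2] using
      s.hasDerivAt_mass hT hε hεR hτ (right_mem_Icc.2 hεR.le)
  have h1 := sub_le_integral_of_deriv_le hc (continuousOn_const (c := (0:ℝ))) hd
    (fun _ _ => le_rfl) ht
  have h2 := sub_le_integral_of_deriv_le hc.neg (continuousOn_const (c := (0:ℝ)))
    (fun τ hτ => (hd τ hτ).neg) (fun _ _ => by simp) ht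
  simp only [s.init_mass, intervalIntegral.integral_zero, add_zero, Pi.neg_apply] at h1 h2
  linarith

/-- Through every interior point passes a particle path, defined on the whole time interval. -/
lemma exists_path {t₀ r₀ : ℝ} (ht₀ : t₀ ∈ Icc 0 T) (hr₀ : r₀ ∈ Icc ε R) :
    ∃ x : ℝ → ℝ, x t₀ = r₀ ∧ ∀ t ∈ Icc 0 T, x t ∈ Icc ε R ∧
      ∫ r in ε..x t, s.ρ t r * r = ∫ r in ε..r₀, s.ρ t₀ r * r := by
  have hnn : ∀ t ∈ Icc 0 T, ∀ r ∈ Icc ε R, 0 ≤ s.ρ t r * r := fun t ht r hr =>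
    mul_nonneg (s.ρ_pos t ht r hr).le (hε.le.trans hr.1)
  have hint : ∀ t ∈ Icc 0 T, ContinuousOn (fun r => s.ρ t r * r) (Icc ε R) := fun t ht =>
    continuousOn_slice_right s.continuousOn_massDensity ht
  have hex : ∀ t ∈ Icc 0 T, ∃ y ∈ Icc ε R,
      ∫ r in ε..y, s.ρ t r * r = ∫ r in ε..r₀, s.ρ t₀ r * r := by
    intro t ht
    have hmem : (∫ r in ε..r₀, s.ρ t₀ r * r) ∈ Icc (∫ r in ε..ε, s.ρ t r * r)
        (∫ r in ε..R, s.ρ t r * r) := by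
      constructor
      · rw [intervalIntegral.integral_same]
        exact intervalIntegral.integral_nonneg hr₀.1
          fun r hr => hnn t₀ ht₀ r ⟨hr.1, hr.2.trans hr₀.2⟩
      · rw [s.integral_mass hT hε hεR ht]
        refine le_of_le_of_eq ?_ (s.integral_mass hT hε hεR ht₀)
        refine intervalIntegral.integral_mono_interval le_rfl hr₀.1 hr₀.2 ?_
          ((hint t₀ ht₀).intervalIntegrable_sub (left_mem_Icc.2 hεR.le) (right_mem_Icc.2 hεR.le))
        exact (ae_restrict_iff' measurableSet_Ioc).2
          (ae_of_all _ fun r hr => hnn t₀ ht₀ r (Ioc_subset_Icc_self hr))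
    exact intermediate_value_Icc hεR.le (continuousOn_primitive_Icc hεR.le (hint t ht)) hmem
  choose! y hy using hex
  refine ⟨Function.update y t₀ r₀, by simp, fun t ht => ?_⟩
  by_cases h : t = t₀
  · subst h; simpa using hr₀
  · simpa [Function.update_of_ne h] using hy t ht

variable {x : ℝ → ℝ} {h : ℝ}
  (hx : ∀ t ∈ Icc 0 T, x t ∈ Icc ε R ∧ ∫ r in ε..x t, s.ρ t r * r = h)
include hx

lemma continuousOn_path : ContinuousOn x (Icc 0 T) :=
  continuousOn_implicit hT.le hεR.le s.continuousOn_massDensity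
    (fun t ht r hr => mul_pos (s.ρ_pos t ht r hr) (hε.trans_le hr.1))
    (fun t ht => (hx t ht).1) fun t ht => (hx t ht).2

lemma hasDerivAt_path {t : ℝ} (ht : t ∈ Ioo 0 T) : HasDerivAt x (s.u t (x t)) t := by
  have htI := Ioo_subset_Icc_self ht
  have hxt := (hx t htI).1
  refine (hasDerivAt_implicit hεR.le s.continuousOn_massDensity
    (fun t ht r hr => mul_pos (s.ρ_pos t ht r hr) (hε.trans_le hr.1))
    (fun t ht => (hx t ht).1) (s.continuousOn_path hT hε hεR hx) (fun t ht => (hx t ht).2) ht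
    (s.hasDerivAt_mass hT hε hεR ht hxt)).congr_deriv ?_
  have h1 := (s.ρ_pos t htI _ hxt).ne'
  have h2 := (hε.trans_le hxt.1).ne'
  field_simp

omit hT in
lemma path_mem_Ioo (hT : 0 < T) (hh : 0 < h) (hhM : h < M₀) {t : ℝ} (ht : t ∈ Icc 0 T) :
    x t ∈ Ioo ε R := by
  obtain ⟨hxt, hxh⟩ := hx t ht
  refine ⟨lt_of_le_of_ne hxt.1 fun he => ?_, lt_of_le_of_ne hxt.2 fun he => ?_⟩
  · rw [← he, intervalIntegral.integral_same] at hxh; exact hh.ne hxh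
  · rw [he, s.integral_mass hT hε hεR ht] at hxh; exact hhM.ne' hxh

end Mass
end ApproxSol
/-- The local form of the entropy balance: the mass, momentum and energy equations combine into a
divergence, minus the dissipation, plus the work of the force. -/
lemma entropy_balance_identity {μ lam κ K r ρ ρt ρr u ut ur urr θ θt θr θrr f lρ lθ : ℝ}
    (hr : r ≠ 0) (hθ : θ ≠ 0)
    (hmass : ρt + (ρr * u + ρ * ur) + ρ * u / r = 0)
    (hmom : (ρt * u + ρ * ut) + (ρr * u ^ 2 + 2 * ρ * u * ur) + ρ * u ^ 2 / r
      + K * (ρr * θ + ρ * θr) - (lam + 2 * μ) * (urr + ur / r - u / r ^ 2) = ρ * f)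
    (hen : (ρt * θ + ρ * θt) + (ρr * u * θ + ρ * ur * θ + ρ * u * θr) + ρ * u * θ / r
      - κ * (θrr + θr / r) + K * ρ * θ * (ur + u / r) = Qvisc μ lam u ur r) :
    r * (K * (ρt * lρ) + (ρt * (θ - lθ - 1) + ρ * (θt - θt / θ))
        + (ρt * (u ^ 2 / 2) + ρ * (u * ut)))
      = (-(ur * (r * (K * (1 + ρ * lρ - ρ) + ρ * (θ - lθ - 1) + ρ * (u ^ 2 / 2)) - K * r)
          + u * ((K * (1 + ρ * lρ - ρ) + ρ * (θ - lθ - 1) + ρ * (u ^ 2 / 2))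
            + r * (K * (ρr * lρ) + (ρr * (θ - lθ - 1) + ρ * (θr - θr / θ))
              + (ρr * (u ^ 2 / 2) + ρ * (u * ur))) - K))
          + κ * ((θr + r * θrr) * (1 - 1 / θ) + r * θr * (θr / θ ^ 2))
          - K * (((ρr * θ + ρ * θr) * u + ρ * θ * ur) * r + ρ * θ * u)
          + (lam + 2 * μ) * (ur * (r * ur + u) + u * (ur + r * urr + ur)) - 4 * μ * u * ur)
        - (κ * ((θr / θ) ^ 2 * r) + Qvisc μ lam u ur r * r / θ) + r * (ρ * u * f) := by
  rw [← sub_eq_zero]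
  have h1 := sub_eq_zero.2 hmom
  have h2 := sub_eq_zero.2 hen
  have : ∀ A m : ℝ, A - m = 0 → m = 0 → A = 0 := fun A m h h' => by linarith
  refine this _ (r * (K * lρ - lθ - u ^ 2 / 2) * (ρt + (ρr * u + ρ * ur) + ρ * u / r)
    + r * u * ((ρt * u + ρ * ut) + (ρr * u ^ 2 + 2 * ρ * u * ur) + ρ * u ^ 2 / r
      + K * (ρr * θ + ρ * θr) - (lam + 2 * μ) * (urr + ur / r - u / r ^ 2) - ρ * f)
    + r * (1 - 1 / θ) * ((ρt * θ + ρ * θt) + (ρr * u * θ + ρ * ur * θ + ρ * u * θr) + ρ * u * θ / r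
      - κ * (θrr + θr / r) + K * ρ * θ * (ur + u / r) - Qvisc μ lam u ur r)) ?_ ?_
  · unfold Qvisc
    field_simp
    ring
  · rw [hmass, h1, h2]; ring

lemma Qvisc_nonneg {μ lam u ur r : ℝ} (hμ : 0 < μ) (hlam : 0 ≤ μ + lam) (hr : 0 < r) :
    0 ≤ Qvisc μ lam u ur r := by
  have : Qvisc μ lam u ur r = (μ + lam) * (ur + u / r) ^ 2 + μ * (ur - u / r) ^ 2 := by
    unfold Qvisc; field_simp; ring
  rw [this]; positivity

lemma one_add_mul_log_sub_nonneg {x : ℝ} (hx : 0 < x) : 0 ≤ 1 + x * Real.log x - x := by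
  have := mul_le_mul_of_nonneg_left (Real.one_sub_inv_le_log_of_pos hx) hx.le
  rw [mul_sub, mul_inv_cancel₀ hx.ne'] at this
  linarith

lemma sub_log_sub_one_nonneg {x : ℝ} (hx : 0 < x) : 0 ≤ x - Real.log x - 1 := by
  linarith [Real.log_le_sub_one_of_pos hx]

namespace ApproxSol

open Function

variable {μ lam κ K ε R T C₀ M₀ Cf : ℝ} (s : ApproxSol μ lam κ K ε R T C₀ M₀ Cf)

/-- The density of the entropy functional. -/
def ent (t r : ℝ) : ℝ :=
  r * (K * (1 + s.ρ t r * Real.log (s.ρ t r) - s.ρ t r)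
    + s.ρ t r * (s.θ t r - Real.log (s.θ t r) - 1) + s.ρ t r * (s.u t r ^ 2 / 2))

/-- The heat dissipation `∫ θ_r² / θ² r dr`. -/
def heatDiss (t : ℝ) : ℝ := ∫ r in ε..R, (s.θr t r / s.θ t r) ^ 2 * r

/-- The sup norm of the force. -/
def forceSup (t : ℝ) : ℝ := ⨆ r : Icc ε R, |s.f t r|

/-- The time derivative of the entropy density. -/
def entT (t r : ℝ) : ℝ :=
  r * (K * (s.ρt t r * Real.log (s.ρ t r))
      + (s.ρt t r * (s.θ t r - Real.log (s.θ t r) - 1)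
        + s.ρ t r * (s.θt t r - s.θt t r / s.θ t r))
    + (s.ρt t r * (s.u t r ^ 2 / 2) + s.ρ t r * (s.u t r * s.ut t r)))

/-- The spatial flux in the entropy balance. -/
def entFlux (t r : ℝ) : ℝ :=
  -(s.u t r * (s.ent t r - K * r)) + κ * (r * s.θr t r * (1 - 1 / s.θ t r))
    - K * (s.ρ t r * s.θ t r * s.u t r * r)
    + (lam + 2 * μ) * (s.u t r * (r * s.ur t r + s.u t r)) - 2 * μ * s.u t r ^ 2

section

lemma continuousOn_ent : ContinuousOn (uncurry s.ent) (Icc 0 T ×ˢ Icc ε R) := by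
  have h1 := s.continuousOn_ρ
  have h2 := s.continuousOn_u
  have h3 := s.continuousOn_θ
  have h4 := h1.log fun p hp => (s.ρ_pos p.1 hp.1 p.2 hp.2).ne'
  have h5 := h3.log fun p hp => (s.θ_pos p.1 hp.1 p.2 hp.2).ne'
  unfold uncurry ent
  fun_prop

lemma hasDerivAt_ent {t r : ℝ} (ht : t ∈ Icc 0 T) (hr : r ∈ Icc ε R) :
    HasDerivAt (fun τ => s.ent τ r) (s.entT t r) t := by
  have hρ := (s.ρ_pos t ht r hr).ne'
  have hθ := (s.θ_pos t ht r hr).ne'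
  have d1 := s.hρt t ht r hr
  have d2 := s.hθt t ht r hr
  have d3 := s.hut t ht r hr
  have h := ((((d1.mul (d1.log hρ)).const_add 1).sub d1).const_mul K).add
    (d1.mul ((d2.sub (d2.log hθ)).sub_const 1)) |>.add (d1.mul ((d3.pow 2).div_const 2))
    |>.const_mul r
  refine h.congr_deriv ?_
  unfold entT
  simp only [Pi.sub_apply, Pi.pow_apply, Nat.cast_ofNat]
  field_simp
  ring

lemma hasDerivAt_entFlux {t r : ℝ} (ht : t ∈ Icc 0 T) (hr : r ∈ Icc ε R) (hε : 0 < ε) :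
    HasDerivAt (s.entFlux t) (s.entT t r
      + (κ * ((s.θr t r / s.θ t r) ^ 2 * r) + Qvisc μ lam (s.u t r) (s.ur t r) r * r / s.θ t r)
      - r * (s.ρ t r * s.u t r * s.f t r)) r := by
  have hρ := (s.ρ_pos t ht r hr).ne'
  have hθ := (s.θ_pos t ht r hr).ne'
  have d1 := s.hρr t ht r hr
  have d2 := s.hθr t ht r hr
  have d3 := s.hur t ht r hr
  have d4 := s.hurr t ht r hr
  have d5 := s.hθrr t ht r hr
  have d0 := hasDerivAt_id r
  have hg := ((((d1.mul (d1.log hρ)).const_add 1).sub d1).const_mul K).add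
    (d1.mul ((d2.sub (d2.log hθ)).sub_const 1)) |>.add (d1.mul ((d3.pow 2).div_const 2))
  have he := d0.mul hg
  have h := (d3.mul (he.sub (d0.const_mul K))).neg.add
    (((d0.mul d5).mul ((d2.inv hθ).const_sub 1)).const_mul κ) |>.sub
    ((((d1.mul d2).mul d3).mul d0).const_mul K) |>.add
    ((d3.mul ((d0.mul d4).add d3)).const_mul (lam + 2 * μ)) |>.sub ((d3.pow 2).const_mul (2 * μ))
  have hid := entropy_balance_identity (hε.trans_le hr.1).ne' hθ (lρ := Real.log (s.ρ t r))
    (lθ := Real.log (s.θ t r)) (s.mass_eq t ht r hr) (s.momentum_eq t ht r hr)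
    (s.energy_eq t ht r hr)
  refine HasDerivAt.congr_deriv (h.congr_of_eventuallyEq (Filter.Eventually.of_forall fun x => ?_))
    ?_
  · simp [entFlux, ent]
  · unfold entT
    rw [hid]
    simp
    field_simp
    ring

lemma entFlux_eq_zero {t : ℝ} (ht : t ∈ Icc 0 T) : s.entFlux t ε = 0 ∧ s.entFlux t R = 0 := by
  obtain ⟨h1, h2⟩ := s.bc_u t ht
  obtain ⟨h3, h4⟩ := s.bc_θ t ht
  simp [entFlux, h1, h2, h3, h4]

end

section

lemma continuousOn_entT (hT : 0 < T) (hεR : ε < R) :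
    ContinuousOn (uncurry s.entT) (Icc 0 T ×ˢ Icc ε R) := by
  have h1 := s.continuousOn_ρ
  have h2 := s.continuousOn_u
  have h3 := s.continuousOn_θ
  have h4 := h1.log fun p hp => (s.ρ_pos p.1 hp.1 p.2 hp.2).ne'
  have h5 := h3.log fun p hp => (s.θ_pos p.1 hp.1 p.2 hp.2).ne'
  have h6 := s.continuousOn_ρt hT hεR
  have h7 := s.continuousOn_ut hT hεR
  have h8 := s.continuousOn_θt hT hεR
  have hn : ∀ p ∈ Icc 0 T ×ˢ Icc ε R, s.θ p.1 p.2 ≠ 0 :=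
    fun p hp => (s.θ_pos p.1 hp.1 p.2 hp.2).ne'
  have hn' : ∀ p ∈ Icc 0 T ×ˢ Icc ε R, s.ρ p.1 p.2 ≠ 0 :=
    fun p hp => (s.ρ_pos p.1 hp.1 p.2 hp.2).ne'
  unfold uncurry entT
  fun_prop (disch := assumption)

lemma continuousOn_heatDensity (hT : 0 < T) (hεR : ε < R) :
    ContinuousOn (uncurry fun t r => (s.θr t r / s.θ t r) ^ 2 * r) (Icc 0 T ×ˢ Icc ε R) :=
  (((s.continuousOn_θr hT hεR).div s.continuousOn_θ
    fun p hp => (s.θ_pos p.1 hp.1 p.2 hp.2).ne').pow 2).mul continuous_snd.continuousOn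

lemma continuousOn_heatDiss (hT : 0 < T) (hεR : ε < R) : ContinuousOn s.heatDiss (Icc 0 T) :=
  continuousOn_integral_const hT.le hεR.le (s.continuousOn_heatDensity hT hεR)

lemma continuousOn_forceSup (hT : 0 < T) (hεR : ε < R) : ContinuousOn s.forceSup (Icc 0 T) :=
  continuousOn_iSup_Icc hT.le hεR.le (g := fun t r => |s.f t r|) (x := fun _ => ε)
    s.continuousOn_f.abs (fun _ _ => left_mem_Icc.2 hεR.le) continuousOn_const

lemma abs_f_le_forceSup {t r : ℝ} (ht : t ∈ Icc 0 T) (hr : r ∈ Icc ε R) :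
    |s.f t r| ≤ s.forceSup t :=
  le_ciSup (bddAbove_range_Icc (g := fun r => |s.f t r|)
    (continuousOn_slice_right (g := s.f) s.continuousOn_f ht).abs) (⟨r, hr⟩ : Icc ε R)

lemma forceSup_nonneg (t : ℝ) : 0 ≤ s.forceSup t :=
  Real.iSup_nonneg fun _ => abs_nonneg _

lemma integral_forceSup_le (hT : 0 < T) (hεR : ε < R) {t : ℝ} (ht : t ∈ Icc 0 T) :
    ∫ τ in (0:ℝ)..t, s.forceSup τ ≤ Cf :=
  (intervalIntegral.integral_mono_interval le_rfl ht.1 ht.2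
    (Filter.Eventually.of_forall fun _ => s.forceSup_nonneg _)
    ((s.continuousOn_forceSup hT hεR).intervalIntegrable_sub (left_mem_Icc.2 hT.le)
      (right_mem_Icc.2 hT.le))).trans s.force_int

lemma heatDiss_nonneg (hε : 0 < ε) (hεR : ε < R) (t : ℝ) : 0 ≤ s.heatDiss t :=
  intervalIntegral.integral_nonneg hεR.le fun _ hr =>
    mul_nonneg (sq_nonneg _) (hε.le.trans hr.1)

lemma ent_terms_nonneg (hε : 0 < ε) {t r : ℝ} (ht : t ∈ Icc 0 T) (hr : r ∈ Icc ε R) :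
    0 < r ∧ 0 ≤ 1 + s.ρ t r * Real.log (s.ρ t r) - s.ρ t r ∧
      0 ≤ s.ρ t r * (s.θ t r - Real.log (s.θ t r) - 1) ∧ 0 ≤ s.ρ t r * (s.u t r ^ 2 / 2) := by
  have hρ := s.ρ_pos t ht r hr
  exact ⟨hε.trans_le hr.1, one_add_mul_log_sub_nonneg hρ,
    mul_nonneg hρ.le (sub_log_sub_one_nonneg (s.θ_pos t ht r hr)), by positivity⟩

lemma integral_ent_zero_le (hT : 0 < T) (hεR : ε < R) : ∫ r in ε..R, s.ent 0 r ≤ C₀ := by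
  refine le_of_eq_of_le (intervalIntegral.integral_congr fun r hr => ?_) s.init_entropy
  rw [uIcc_of_le hεR.le] at hr
  have hρ := (s.ρ_pos 0 (left_mem_Icc.2 hT.le) r hr).ne'
  simp only [ent, Psi, one_div, Real.log_inv]
  field_simp
  ring

/-- The entropy estimate. -/
lemma entropy_estimate (hμ : 0 < μ) (hlam : 0 ≤ μ + lam) (hK : 0 < K) (hκ : 0 < κ)
    (hM₀ : 0 < M₀) (hC₀ : 1 ≤ C₀)
    (hT : 0 < T) (hε : 0 < ε) (hεR : ε < R) {t : ℝ} (ht : t ∈ Icc 0 T) :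
    (∫ r in ε..R, s.ent t r) + M₀ + κ * ∫ τ in (0:ℝ)..t, s.heatDiss τ
      ≤ (C₀ + M₀) * Real.exp Cf := by
  have hl := left_mem_Icc.2 hεR.le
  have hrr := right_mem_Icc.2 hεR.le
  have hV := s.continuousOn_heatDiss hT hεR
  have hφ := s.continuousOn_forceSup hT hεR
  have hE := continuousOn_integral_const hT.le hεR.le s.continuousOn_ent
  have hd : ∀ τ ∈ Ioo 0 T, HasDerivAt
      (fun t => (∫ r in ε..R, s.ent t r) + M₀ + κ * ∫ τ in (0:ℝ)..t, s.heatDiss τ)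
      ((∫ r in ε..R, s.entT τ r) + κ * s.heatDiss τ) τ := fun τ hτ =>
    ((hasDerivAt_integral_param s.continuousOn_ent (s.continuousOn_entT hT hεR)
      (fun t ht r hr => s.hasDerivAt_ent (Ioo_subset_Icc_self ht) hr) hτ hl hrr).add_const M₀).add
      ((hasDerivAt_primitive hV hτ).const_mul κ)
  have hle : ∀ τ ∈ Ioo 0 T, (∫ r in ε..R, s.entT τ r) + κ * s.heatDiss τ ≤ s.forceSup τ *
      ((∫ r in ε..R, s.ent τ r) + M₀ + κ * ∫ τ in (0:ℝ)..τ, s.heatDiss τ) := by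
    intro τ hτ
    have hτI := Ioo_subset_Icc_self hτ
    have i1 := (continuousOn_slice_right (s.continuousOn_entT hT hεR) hτI).intervalIntegrable_sub
      hl hrr
    have i2 := (continuousOn_slice_right (s.continuousOn_heatDensity hT hεR)
      hτI).intervalIntegrable_sub hl hrr
    have i3 := (continuousOn_slice_right s.continuousOn_ent hτI).intervalIntegrable_sub hl hrr
    have i4 := (continuousOn_slice_right s.continuousOn_massDensity hτI).intervalIntegrable_sub
      hl hrr
    have cρ := continuousOn_slice_right (g := s.ρ) s.continuousOn_ρ hτI
    have cu := continuousOn_slice_right (g := s.u) s.continuousOn_u hτI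
    have cf := continuousOn_slice_right (g := s.f) s.continuousOn_f hτI
    have cθ := continuousOn_slice_right (g := s.θ) s.continuousOn_θ hτI
    have cur := continuousOn_slice_right (g := s.ur) (s.continuousOn_ur hT hεR) hτI
    have cQ : ContinuousOn (fun r => Qvisc μ lam (s.u τ r) (s.ur τ r) r * r / s.θ τ r)
        (Icc ε R) := by
      refine ContinuousOn.div ?_ cθ fun r hr => (s.θ_pos τ hτI r hr).ne'
      have : ∀ r ∈ Icc ε R, r ≠ 0 := fun r hr => (hε.trans_le hr.1).ne'
      unfold Qvisc
      fun_prop (disch := assumption)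
    have hftc := intervalIntegral.integral_eq_sub_of_hasDerivAt (a := ε) (b := R)
      (fun r hr => s.hasDerivAt_entFlux hτI (by rwa [uIcc_of_le hεR.le] at hr) hε)
      ((i1.add ((i2.const_mul κ).add (cQ.intervalIntegrable_sub hl hrr))).sub
        (ContinuousOn.intervalIntegrable_sub (by fun_prop) hl hrr))
    rw [(s.entFlux_eq_zero hτI).1, (s.entFlux_eq_zero hτI).2, sub_zero] at hftc
    have hV0 : 0 ≤ ∫ x in (0:ℝ)..τ, s.heatDiss x :=
      intervalIntegral.integral_nonneg hτ.1.le fun _ _ => s.heatDiss_nonneg hε hεR _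
    have hmono := intervalIntegral.integral_mono_on hεR.le
      (i1.add (i2.const_mul κ)) (((i1.add ((i2.const_mul κ).add
        (cQ.intervalIntegrable_sub hl hrr))).sub
        (ContinuousOn.intervalIntegrable_sub (g := fun r => r * (s.ρ τ r * s.u τ r * s.f τ r))
          (by fun_prop) hl hrr)).add ((i3.add i4).const_mul (s.forceSup τ)))
      (fun r hr => ?_)
    · rw [intervalIntegral.integral_add i1 (i2.const_mul κ), intervalIntegral.integral_const_mul,
        intervalIntegral.integral_add ((i1.add ((i2.const_mul κ).add
        (cQ.intervalIntegrable_sub hl hrr))).sub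
        (ContinuousOn.intervalIntegrable_sub (by fun_prop) hl hrr))
        ((i3.add i4).const_mul (s.forceSup τ)), intervalIntegral.integral_const_mul,
        intervalIntegral.integral_add i3 i4, s.integral_mass hT hε hεR hτI] at hmono
      have := mul_nonneg (s.forceSup_nonneg τ) (mul_nonneg hκ.le hV0)
      have hVd : s.heatDiss τ = ∫ r in ε..R, (s.θr τ r / s.θ τ r) ^ 2 * r := rfl
      rw [hVd]
      linarith
    · obtain ⟨hr0, e1, e2, e3⟩ := s.ent_terms_nonneg hε hτI hr
      have hQ : 0 ≤ Qvisc μ lam (s.u τ r) (s.ur τ r) r * r / s.θ τ r :=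
        div_nonneg (mul_nonneg (Qvisc_nonneg hμ hlam hr0) hr0.le) (s.θ_pos τ hτI r hr).le
      have hf := s.abs_f_le_forceSup hτI hr
      have hρ := s.ρ_pos τ hτI r hr
      have huf : s.u τ r * s.f τ r ≤ s.forceSup τ * (s.u τ r ^ 2 / 2 + 1) := by
        refine (le_abs_self _).trans ?_
        rw [abs_mul, mul_comm]
        refine mul_le_mul hf ?_ (abs_nonneg _) (s.forceSup_nonneg τ)
        nlinarith [sq_nonneg (|s.u τ r| - 1), sq_abs (s.u τ r)]
      have h1 : r * (s.ρ τ r * s.u τ r * s.f τ r)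
          ≤ s.forceSup τ * (r * (s.ρ τ r * (s.u τ r ^ 2 / 2)) + s.ρ τ r * r) := by
        have := mul_le_mul_of_nonneg_left huf (mul_pos hr0 hρ).le
        linarith
      have h2 : s.forceSup τ * (r * (s.ρ τ r * (s.u τ r ^ 2 / 2)) + s.ρ τ r * r)
          ≤ s.forceSup τ * (s.ent τ r + s.ρ τ r * r) := by
        refine mul_le_mul_of_nonneg_left ?_ (s.forceSup_nonneg τ)
        unfold ent
        have := mul_nonneg hr0.le (add_nonneg (mul_nonneg hK.le e1) e2)
        linarith
      linarith
  refine (gronwall_le ((hE.add continuousOn_const).add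
    (continuousOn_const.mul (continuousOn_primitive_Icc hT.le hV))) hφ hd hle ht).trans ?_
  have h0 := s.integral_ent_zero_le hT hεR
  have h1 : 0 ≤ C₀ + M₀ := by linarith
  have h2 := s.integral_forceSup_le hT hεR ht
  simp only [Pi.add_apply, Pi.mul_apply, intervalIntegral.integral_same, mul_zero, add_zero]
  exact mul_le_mul (by linarith) (Real.exp_le_exp.2 h2) (Real.exp_pos _).le h1

end

end ApproxSol
lemma ContinuousOn.integral_le_integral_sub {g : ℝ → ℝ} {a b x y : ℝ}
    (hg : ContinuousOn g (Icc a b)) (h0 : ∀ r ∈ Icc a b, 0 ≤ g r) (hax : a ≤ x) (hxy : x ≤ y)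
    (hyb : y ≤ b) : ∫ r in x..y, g r ≤ ∫ r in a..b, g r :=
  intervalIntegral.integral_mono_interval hax hxy hyb
    ((ae_restrict_iff' measurableSet_Ioc).2
      (ae_of_all _ fun r hr => h0 r (Ioc_subset_Icc_self hr)))
    (hg.intervalIntegrable_sub (left_mem_Icc.2 (hax.trans (hxy.trans hyb)))
      (right_mem_Icc.2 (hax.trans (hxy.trans hyb))))

lemma ContinuousOn.integral_mono_sub {g₁ g₂ : ℝ → ℝ} {a b x y : ℝ}
    (hg₁ : ContinuousOn g₁ (Icc a b)) (hg₂ : ContinuousOn g₂ (Icc a b))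
    (hax : a ≤ x) (hxy : x ≤ y) (hyb : y ≤ b) (h : ∀ r ∈ Icc x y, g₁ r ≤ g₂ r) :
    ∫ r in x..y, g₁ r ≤ ∫ r in x..y, g₂ r := by
  have hx : x ∈ Icc a b := ⟨hax, hxy.trans hyb⟩
  have hy : y ∈ Icc a b := ⟨hax.trans hxy, hyb⟩
  exact intervalIntegral.integral_mono_on hxy (hg₁.intervalIntegrable_sub hx hy)
    (hg₂.intervalIntegrable_sub hx hy) h

lemma le_two_mul_sub_log {x : ℝ} (hx : 0 < x) : x ≤ 2 * (x - Real.log x - 1) + 2 := by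
  have h1 := Real.log_le_sub_one_of_pos (half_pos hx)
  rw [Real.log_div hx.ne' two_ne_zero] at h1
  have := Real.log_two_lt_d9
  linarith

/-- Superlinearity of the density entropy. -/
lemma le_exp_add_entropy_div {x N : ℝ} (hx : 0 < x) (hN : 0 < N) :
    x ≤ Real.exp (N + 1) + (1 + x * Real.log x - x) / N := by
  rcases le_or_gt x (Real.exp (N + 1)) with h | h
  · have := div_nonneg (one_add_mul_log_sub_nonneg hx) hN.le
    linarith
  · have h1 : N + 1 ≤ Real.log x := (Real.le_log_iff_exp_le hx).2 h.le
    have h2 : x ≤ (1 + x * Real.log x - x) / N := by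
      rw [le_div_iff₀ hN]; nlinarith [mul_le_mul_of_nonneg_left h1 hx.le]
    have := Real.exp_pos (N + 1)
    linarith

namespace ApproxSol

open Function

section Energy

variable {μ lam κ K ε R T C₀ M₀ Cf E : ℝ} (s : ApproxSol μ lam κ K ε R T C₀ M₀ Cf)
  (hK : 0 < K) (hT : 0 < T) (hε : 0 < ε) (hεR : ε < R)
include hT hε hεR

lemma integral_le_of_le_ent {t : ℝ} (ht : t ∈ Icc 0 T) {g : ℝ → ℝ} {a b : ℝ}
    (hg : ContinuousOn g (Icc ε R)) (hga : ∀ r ∈ Icc ε R, g r ≤ a * s.ent t r + b * (s.ρ t r * r)) :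
    ∫ r in ε..R, g r ≤ a * (∫ r in ε..R, s.ent t r) + b * M₀ := by
  have c1 := continuousOn_slice_right s.continuousOn_ent ht
  have c2 := continuousOn_slice_right s.continuousOn_massDensity ht
  have hl := left_mem_Icc.2 hεR.le
  have hr := right_mem_Icc.2 hεR.le
  have h := hg.integral_mono_sub (g₂ := fun r => a * s.ent t r + b * (s.ρ t r * r))
    ((continuousOn_const.mul c1).add (continuousOn_const.mul c2)) le_rfl hεR.le le_rfl hga
  rwa [intervalIntegral.integral_add ((c1.intervalIntegrable_sub hl hr).const_mul a)
    ((c2.intervalIntegrable_sub hl hr).const_mul b), intervalIntegral.integral_const_mul,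
    intervalIntegral.integral_const_mul, s.integral_mass hT hε hεR ht] at h

include hK

omit hT in
lemma integral_ent_nonneg {t : ℝ} (ht : t ∈ Icc 0 T) : 0 ≤ ∫ r in ε..R, s.ent t r :=
  intervalIntegral.integral_nonneg hεR.le fun r hr => by
    obtain ⟨h0, h1, h2, h3⟩ := s.ent_terms_nonneg hε ht hr
    unfold ent
    positivity

lemma integral_abs_momentum_le {t : ℝ} (ht : t ∈ Icc 0 T)
    (hE : (∫ r in ε..R, s.ent t r) + M₀ ≤ E) :
    ∫ r in ε..R, s.ρ t r * |s.u t r| * r ≤ E := by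
  have cρ := continuousOn_slice_right (g := s.ρ) s.continuousOn_ρ ht
  have cu := (continuousOn_slice_right (g := s.u) s.continuousOn_u ht).abs
  refine (s.integral_le_of_le_ent (a := 1) (b := 1) hT hε hεR ht (by fun_prop)
    fun r hr => ?_).trans (by linarith)
  obtain ⟨h0, h1, h2, h3⟩ := s.ent_terms_nonneg hε ht hr
  have hρ := s.ρ_pos t ht r hr
  have h4 : |s.u t r| ≤ s.u t r ^ 2 / 2 + 1 := by
    nlinarith [sq_nonneg (|s.u t r| - 1), sq_abs (s.u t r)]
  have h5 := mul_le_mul_of_nonneg_left h4 (mul_pos hρ h0).le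
  have h6 := mul_nonneg h0.le (add_nonneg (mul_nonneg hK.le h1) h2)
  unfold ent
  linarith

lemma integral_kinetic_le {t : ℝ} (ht : t ∈ Icc 0 T) (hM₀ : 0 < M₀)
    (hE : (∫ r in ε..R, s.ent t r) + M₀ ≤ E) :
    ∫ r in ε..R, s.ρ t r * s.u t r ^ 2 * r ≤ 2 * E := by
  have cρ := continuousOn_slice_right (g := s.ρ) s.continuousOn_ρ ht
  have cu := continuousOn_slice_right (g := s.u) s.continuousOn_u ht
  refine (s.integral_le_of_le_ent (a := 2) (b := 0) hT hε hεR ht (by fun_prop)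
    fun r hr => ?_).trans (by linarith)
  obtain ⟨h0, h1, h2, h3⟩ := s.ent_terms_nonneg hε ht hr
  have h6 := mul_nonneg h0.le (add_nonneg (mul_nonneg hK.le h1) h2)
  unfold ent
  linarith

lemma integral_thermal_le {t : ℝ} (ht : t ∈ Icc 0 T)
    (hE : (∫ r in ε..R, s.ent t r) + M₀ ≤ E) :
    ∫ r in ε..R, s.ρ t r * s.θ t r * r ≤ 2 * E := by
  have cρ := continuousOn_slice_right (g := s.ρ) s.continuousOn_ρ ht
  have cθ := continuousOn_slice_right (g := s.θ) s.continuousOn_θ ht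
  refine (s.integral_le_of_le_ent (a := 2) (b := 2) hT hε hεR ht (by fun_prop)
    fun r hr => ?_).trans (by linarith)
  obtain ⟨h0, h1, h2, h3⟩ := s.ent_terms_nonneg hε ht hr
  have hρ := s.ρ_pos t ht r hr
  have h5 := mul_le_mul_of_nonneg_left (le_two_mul_sub_log (s.θ_pos t ht r hr)) (mul_pos hρ h0).le
  have h6 := mul_nonneg h0.le (add_nonneg (mul_nonneg hK.le h1) h3)
  unfold ent
  linarith

omit hT hεR in
lemma integral_mass_le {t : ℝ} (ht : t ∈ Icc 0 T) (hM₀ : 0 < M₀)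
    (hE : (∫ r in ε..R, s.ent t r) + M₀ ≤ E) {N x y : ℝ} (hN : 0 < N) (hx : ε ≤ x) (hxy : x ≤ y)
    (hy : y ≤ R) :
    ∫ r in x..y, s.ρ t r * r ≤ Real.exp (N + 1) * ((y ^ 2 - x ^ 2) / 2) + E / (K * N) := by
  have c1 := continuousOn_slice_right s.continuousOn_ent ht
  have c2 := continuousOn_slice_right s.continuousOn_massDensity ht
  have hxI : x ∈ Icc ε R := ⟨hx, hxy.trans hy⟩
  have hyI : y ∈ Icc ε R := ⟨hx.trans hxy, hy⟩
  have h := c2.integral_mono_sub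
    (g₂ := fun r => Real.exp (N + 1) * r + (K * N)⁻¹ * s.ent t r) (by fun_prop) hx hxy hy
    fun r hr => by
      have hrI : r ∈ Icc ε R := ⟨hx.trans hr.1, hr.2.trans hy⟩
      obtain ⟨h0, h1, h2, h3⟩ := s.ent_terms_nonneg hε ht hrI
      have h4 := mul_le_mul_of_nonneg_left (le_exp_add_entropy_div (s.ρ_pos t ht r hrI) hN) h0.le
      have h5 : r * (K * (1 + s.ρ t r * Real.log (s.ρ t r) - s.ρ t r)) ≤ s.ent t r := by
        unfold ent
        have := mul_nonneg h0.le (add_nonneg h2 h3)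
        linarith
      have h6 := mul_le_mul_of_nonneg_left h5 (inv_nonneg.2 (mul_pos hK hN).le)
      have h7 : (K * N)⁻¹ * (r * (K * (1 + s.ρ t r * Real.log (s.ρ t r) - s.ρ t r)))
          = r * ((1 + s.ρ t r * Real.log (s.ρ t r) - s.ρ t r) / N) := by
        field_simp
      rw [h7] at h6
      linarith
  have hid : ContinuousOn (fun r : ℝ => r) (Icc ε R) := continuousOn_id
  rw [intervalIntegral.integral_add ((hid.intervalIntegrable_sub hxI hyI).const_mul _)
    ((c1.intervalIntegrable_sub hxI hyI).const_mul _), intervalIntegral.integral_const_mul,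
    intervalIntegral.integral_const_mul, integral_id] at h
  refine h.trans (add_le_add le_rfl ?_)
  rw [div_eq_inv_mul]
  refine mul_le_mul_of_nonneg_left ?_ (inv_nonneg.2 (mul_pos hK hN).le)
  refine (c1.integral_le_integral_sub (fun r hr => ?_) hx hxy hy).trans (by linarith)
  obtain ⟨h0, h1, h2, h3⟩ := s.ent_terms_nonneg hε ht hr
  unfold ent
  positivity

omit hT in
/-- A set carrying a definite mass has a definite area. -/
lemma mass_le_area {t : ℝ} (ht : t ∈ Icc 0 T) (hM₀ : 0 < M₀)
    (hE : (∫ r in ε..R, s.ent t r) + M₀ ≤ E) {m x y : ℝ} (hm : 0 < m) (hx : ε ≤ x) (hxy : x ≤ y)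
    (hy : y ≤ R) (hmass : ∫ r in x..y, s.ρ t r * r = m) :
    m * Real.exp (-(2 * E / (K * m) + 1)) ≤ y ^ 2 - x ^ 2 := by
  have hE0 : 0 < E := by linarith [s.integral_ent_nonneg hK hε hεR ht]
  have h := s.integral_mass_le hK hε ht hM₀ hE (N := 2 * E / (K * m)) (by positivity)
    hx hxy hy
  rw [hmass, show E / (K * (2 * E / (K * m))) = m / 2 by field_simp] at h
  rw [Real.exp_neg, ← div_eq_mul_inv, div_le_iff₀ (Real.exp_pos _)]
  linarith

end Energy

end ApproxSol
namespace ApproxSol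

open Function

section Potential

variable {μ lam κ K ε R T C₀ M₀ Cf : ℝ} (s : ApproxSol μ lam κ K ε R T C₀ M₀ Cf)

/-- The momentum carried by the shell `[y, R]`, without the geometric weight. -/
def mom (t y : ℝ) : ℝ := ∫ r in y..R, s.ρ t r * s.u t r

/-- The lower order terms in the momentum balance of the shell `[y, R]`. -/
def src (t y : ℝ) : ℝ := ∫ r in y..R, (s.ρ t r * s.f t r - s.ρ t r * s.u t r ^ 2 / r)

/-- The pressure. -/
def pres (t r : ℝ) : ℝ := K * s.ρ t r * s.θ t r

/-- The potential of the effective viscous flux. -/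
def ell (t y : ℝ) : ℝ :=
  (lam + 2 * μ) * Real.log (s.ρ t R) + (∫ τ in (0:ℝ)..t, s.pres τ R) + s.mom t y

/-- The time derivative of `ell`. -/
def ellT (t y : ℝ) : ℝ :=
  s.ρ t y * s.u t y ^ 2 + s.pres t y - (lam + 2 * μ) * (s.ur t y + s.u t y / y) + s.src t y

/-- The integrating factor of the density along particle paths. -/
def fac (t y : ℝ) : ℝ := Real.exp (s.ell t y / (lam + 2 * μ))

variable (hT : 0 < T) (hε : 0 < ε) (hεR : ε < R)

lemma continuousOn_pres : ContinuousOn (uncurry s.pres) (Icc 0 T ×ˢ Icc ε R) := by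
  have h1 := s.continuousOn_ρ
  have h3 := s.continuousOn_θ
  unfold uncurry pres
  fun_prop

include hT hεR

lemma continuousOn_mom : ContinuousOn (uncurry s.mom) (Icc 0 T ×ˢ Icc ε R) :=
  continuousOn_integral_upper hT.le hεR.le (s.continuousOn_ρ.mul s.continuousOn_u)

lemma continuousOn_ell : ContinuousOn (uncurry s.ell) (Icc 0 T ×ˢ Icc ε R) := by
  have hR := right_mem_Icc.2 hεR.le
  have h1 : ContinuousOn (fun t => (lam + 2 * μ) * Real.log (s.ρ t R)
      + ∫ τ in (0:ℝ)..t, s.pres τ R) (Icc 0 T) :=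
    (continuousOn_const.mul ((continuousOn_slice_left (g := s.ρ) s.continuousOn_ρ hR).log
      fun t ht => (s.ρ_pos t ht R hR).ne')).add
      (continuousOn_primitive_Icc hT.le (continuousOn_slice_left s.continuousOn_pres hR))
  exact (h1.comp continuous_fst.continuousOn fun p hp => hp.1).add (s.continuousOn_mom hT hεR)

lemma continuousOn_fac : ContinuousOn (uncurry s.fac) (Icc 0 T ×ˢ Icc ε R) :=
  ((s.continuousOn_ell hT hεR).div_const _).rexp

include hε

omit hT hεR in
lemma continuousOn_srcDensity : ContinuousOn
    (uncurry fun t r => s.ρ t r * s.f t r - s.ρ t r * s.u t r ^ 2 / r)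
    (Icc 0 T ×ˢ Icc ε R) := by
  have h1 := s.continuousOn_ρ
  have h2 := s.continuousOn_u
  have h3 := s.continuousOn_f
  have h4 : ∀ p ∈ Icc 0 T ×ˢ Icc ε R, p.2 ≠ 0 := fun p hp => (hε.trans_le hp.2.1).ne'
  unfold uncurry
  fun_prop (disch := assumption)

lemma continuousOn_src : ContinuousOn (uncurry s.src) (Icc 0 T ×ˢ Icc ε R) :=
  continuousOn_integral_upper hT.le hεR.le (s.continuousOn_srcDensity hε)

lemma continuousOn_ellT : ContinuousOn (uncurry s.ellT) (Icc 0 T ×ˢ Icc ε R) := by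
  have h1 := s.continuousOn_ρ
  have h2 := s.continuousOn_u
  have h3 := s.continuousOn_ur hT hεR
  have h4 : ∀ p ∈ Icc 0 T ×ˢ Icc ε R, p.2 ≠ 0 := fun p hp => (hε.trans_le hp.2.1).ne'
  have h5 := s.continuousOn_src hT hε hεR
  have h6 := s.continuousOn_pres
  unfold uncurry at h5 h6
  unfold uncurry ellT
  fun_prop (disch := assumption)

/-- The balance of momentum in the shell `[y, R]`. -/
lemma hasDerivAt_mom_time {t y : ℝ} (ht : t ∈ Ioo 0 T) (hy : y ∈ Icc ε R) :
    HasDerivAt (fun τ => s.mom τ y)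
      (s.ρ t y * s.u t y ^ 2 + s.pres t y - (lam + 2 * μ) * (s.ur t y + s.u t y / y) + s.src t y
        + ((lam + 2 * μ) * s.ur t R - s.pres t R)) t := by
  have htI := Ioo_subset_Icc_self ht
  have hR := right_mem_Icc.2 hεR.le
  have hct : ContinuousOn (uncurry fun t r => s.ρt t r * s.u t r + s.ρ t r * s.ut t r)
      (Icc 0 T ×ˢ Icc ε R) :=
    ((s.continuousOn_ρt hT hεR).mul s.continuousOn_u).add
      (s.continuousOn_ρ.mul (s.continuousOn_ut hT hεR))
  refine (hasDerivAt_integral_param (g := fun t r => s.ρ t r * s.u t r)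
    (s.continuousOn_ρ.mul s.continuousOn_u) hct
    (fun τ hτ r hr => (s.hρt τ (Ioo_subset_Icc_self hτ) r hr).mul
      (s.hut τ (Ioo_subset_Icc_self hτ) r hr)) ht hy hR).congr_deriv ?_
  have i1 := (continuousOn_slice_right hct htI).intervalIntegrable_sub hy hR
  have i2 := (continuousOn_slice_right
    (s.continuousOn_srcDensity hε) htI).intervalIntegrable_sub hy hR
  have h := intervalIntegral.integral_eq_sub_of_hasDerivAt
    (f := fun r => -(s.ρ t r * s.u t r ^ 2) - K * (s.ρ t r * s.θ t r)
      + (lam + 2 * μ) * (s.ur t r + s.u t r / r))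
    (f' := fun r => (s.ρt t r * s.u t r + s.ρ t r * s.ut t r)
      - (s.ρ t r * s.f t r - s.ρ t r * s.u t r ^ 2 / r)) (a := y) (b := R)
    (fun r hr => ?_) (i1.sub i2)
  · rw [intervalIntegral.integral_sub i1 i2, (s.bc_u t htI).2, sub_eq_iff_eq_add] at h
    rw [h]
    simp only [pres, src]
    ring
  · have hr' := uIcc_subset_Icc hy hR hr
    have hr0 : r ≠ 0 := (hε.trans_le hr'.1).ne'
    have d1 := s.hρr t htI r hr'
    have d2 := s.hur t htI r hr'
    have d3 := s.hθr t htI r hr'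
    have d4 := s.hurr t htI r hr'
    refine (((d1.mul (d2.pow 2)).neg.sub ((d1.mul d3).const_mul K)).add
      ((d4.add (d2.div (hasDerivAt_id r) hr0)).const_mul (lam + 2 * μ))).congr_deriv ?_
    have hm := s.momentum_eq t htI r hr'
    simp only [Pi.pow_apply, id]
    have : (s.ur t r * r - s.u t r * 1) / r ^ 2 = s.ur t r / r - s.u t r / r ^ 2 := by
      field_simp
    rw [this]
    push_cast
    linear_combination -hm

lemma hasDerivAt_ell_time {t y : ℝ} (ht : t ∈ Ioo 0 T)
    (hy : y ∈ Icc ε R) : HasDerivAt (fun τ => s.ell τ y) (s.ellT t y) t := by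
  have htI := Ioo_subset_Icc_self ht
  have hR := right_mem_Icc.2 hεR.le
  have hρ := (s.ρ_pos t htI R hR).ne'
  refine ((((s.hρt t htI R hR).log hρ).const_mul (lam + 2 * μ)).add
    (hasDerivAt_primitive (continuousOn_slice_left s.continuousOn_pres hR) ht)
    |>.add (s.hasDerivAt_mom_time hT hε hεR ht hy)).congr_deriv ?_
  have hm := s.mass_eq t htI R hR
  rw [(s.bc_u t htI).2] at hm
  have : s.ρt t R / s.ρ t R = -s.ur t R := by
    rw [div_eq_iff hρ]; simp at hm; linear_combination hm
  rw [this]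
  unfold ellT
  ring

omit hT hε in
lemma hasDerivAt_ell_space {t y : ℝ} (ht : t ∈ Icc 0 T) (hy : y ∈ Ioo ε R) :
    HasDerivAt (s.ell t) (-(s.ρ t y * s.u t y)) y := by
  have c := continuousOn_slice_right (g := fun t r => s.ρ t r * s.u t r)
    (s.continuousOn_ρ.mul s.continuousOn_u) ht
  have hR := right_mem_Icc.2 hεR.le
  have hl := left_mem_Icc.2 hεR.le
  have h := ((hasDerivAt_primitive c hy).const_sub (∫ r in ε..R, s.ρ t r * s.u t r)).const_add
    ((lam + 2 * μ) * Real.log (s.ρ t R) + ∫ τ in (0:ℝ)..t, s.pres τ R)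
  refine h.congr_of_eventuallyEq ?_
  filter_upwards [Ioo_mem_nhds hy.1 hy.2] with z hz
  have hz' := Ioo_subset_Icc_self hz
  simp only [ell, mom]
  rw [intervalIntegral.integral_interval_sub_left (c.intervalIntegrable_sub hl hR)
    (c.intervalIntegrable_sub hl hz')]

/-- Along particle paths `ell - ν log ρ` grows at the rate `P + G`. -/
lemma hasDerivAt_ell_sub_log {t : ℝ} (ht : t ∈ Ioo 0 T) {x : ℝ → ℝ}
    (hx : x t ∈ Ioo ε R) (hxd : HasDerivAt x (s.u t (x t)) t) :
    HasDerivAt (fun τ => s.ell τ (x τ) - (lam + 2 * μ) * Real.log (s.ρ τ (x τ)))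
      (s.pres t (x t) + s.src t (x t)) t := by
  have htI := Ioo_subset_Icc_self ht
  have hxI := Ioo_subset_Icc_self hx
  have h1 := hasDerivAt_along (f := s.ell) (ft := s.ellT) (fr := fun t y => -(s.ρ t y * s.u t y))
    (s.continuousOn_ellT hT hε hεR) (s.continuousOn_ρ.mul s.continuousOn_u).neg
    (fun t ht r hr => s.hasDerivAt_ell_time hT hε hεR ht (Ioo_subset_Icc_self hr))
    (fun t ht r hr => s.hasDerivAt_ell_space hεR (Ioo_subset_Icc_self ht) hr) ht hx hxd
  have h2 := hasDerivAt_along (f := s.ρ) (ft := s.ρt) (fr := s.ρr)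
    (s.continuousOn_ρt hT hεR) (s.continuousOn_ρr hT hεR)
    (fun t ht r hr => s.hρt t (Ioo_subset_Icc_self ht) r (Ioo_subset_Icc_self hr))
    (fun t ht r hr => s.hρr t (Ioo_subset_Icc_self ht) r (Ioo_subset_Icc_self hr)) ht hx hxd
  have hρ := (s.ρ_pos t htI _ hxI).ne'
  refine (h1.sub ((h2.log hρ).const_mul (lam + 2 * μ))).congr_deriv ?_
  have hm := s.mass_eq t htI _ hxI
  have : (s.ρt t (x t) + s.ρr t (x t) * s.u t (x t)) / s.ρ t (x t)
      = -(s.ur t (x t) + s.u t (x t) / x t) := by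
    rw [div_eq_iff hρ]; linear_combination hm
  rw [this]
  unfold ellT
  ring

/-- The rate of change of the weighted area of the region outside a particle path. -/
lemma hasDerivAt_integral_fac (hν : lam + 2 * μ ≠ 0) {t : ℝ} (ht : t ∈ Ioo 0 T) {x : ℝ → ℝ}
    (hx : x t ∈ Ioo ε R) (hxd : HasDerivAt x (s.u t (x t)) t) :
    HasDerivAt (fun τ => ∫ r in x τ..R, s.fac τ r * r)
      (∫ r in x t..R, s.fac t r * r * ((s.pres t r + s.src t r) / (lam + 2 * μ))) t := by
  have htI := Ioo_subset_Icc_self ht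
  have hxI := Ioo_subset_Icc_self hx
  have hR := right_mem_Icc.2 hεR.le
  have hl := left_mem_Icc.2 hεR.le
  have c0 : ContinuousOn (uncurry fun t r => s.fac t r * r) (Icc 0 T ×ˢ Icc ε R) :=
    (s.continuousOn_fac hT hεR).mul continuous_snd.continuousOn
  have c1 : ContinuousOn (uncurry fun t r => s.fac t r * (s.ellT t r / (lam + 2 * μ)) * r)
      (Icc 0 T ×ˢ Icc ε R) :=
    ((s.continuousOn_fac hT hεR).mul ((s.continuousOn_ellT hT hε hεR).div_const _)).mul
      continuous_snd.continuousOn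
  have h1 := hasDerivAt_along (f := fun t y => ∫ r in y..R, s.fac t r * r)
    (ft := fun t y => ∫ r in y..R, s.fac t r * (s.ellT t r / (lam + 2 * μ)) * r)
    (fr := fun t y => -(s.fac t y * y))
    (continuousOn_integral_upper hT.le hεR.le c1) c0.neg
    (fun t ht r hr => hasDerivAt_integral_param c0 c1 (fun t ht r hr =>
      ((s.hasDerivAt_ell_time hT hε hεR ht hr).div_const _).exp.mul_const r) ht
      (Ioo_subset_Icc_self hr) hR)
    (fun t ht r hr => by
      have c := continuousOn_slice_right c0 (Ioo_subset_Icc_self ht)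
      refine ((hasDerivAt_primitive c hr).const_sub
        (∫ r in ε..R, s.fac t r * r)).congr_of_eventuallyEq ?_
      filter_upwards [Ioo_mem_nhds hr.1 hr.2] with z hz
      rw [intervalIntegral.integral_interval_sub_left (c.intervalIntegrable_sub hl hR)
        (c.intervalIntegrable_sub hl (Ioo_subset_Icc_self hz))]) ht hx hxd
  refine h1.congr_deriv ?_
  have cF := continuousOn_slice_right (s.continuousOn_fac hT hεR) htI
  have cu := continuousOn_slice_right (g := s.u) s.continuousOn_u htI
  have cρ := continuousOn_slice_right (g := s.ρ) s.continuousOn_ρ htI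
  have cur := continuousOn_slice_right (g := s.ur) (s.continuousOn_ur hT hεR) htI
  have cP := continuousOn_slice_right s.continuousOn_pres htI
  have cS := continuousOn_slice_right (s.continuousOn_src hT hε hεR) htI
  have i1 := (continuousOn_slice_right c1 htI).intervalIntegrable_sub hxI hR
  have i2 : IntervalIntegrable
      (fun r => s.fac t r * r * ((s.pres t r + s.src t r) / (lam + 2 * μ))) volume (x t) R :=
    ContinuousOn.intervalIntegrable_sub (by fun_prop) hxI hR
  have hsub : Icc (x t) R ⊆ Icc ε R := Icc_subset_Icc_left hxI.1
  have hftc := intervalIntegral.integral_eq_sub_of_hasDerivAt_of_le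
    (f := fun r => s.fac t r * (r * s.u t r))
    (f' := fun r => s.fac t r * r * ((s.pres t r + s.src t r) / (lam + 2 * μ))
      - s.fac t r * (s.ellT t r / (lam + 2 * μ)) * r) hx.2.le
    (ContinuousOn.mono (by fun_prop) hsub) (fun r hr => ?_) (i2.sub i1)
  · rw [intervalIntegral.integral_sub i2 i1, (s.bc_u t htI).2] at hftc
    linear_combination -hftc
  · have hr' : r ∈ Ioo ε R := ⟨hx.1.trans hr.1, hr.2⟩
    have hr0 : r ≠ 0 := (hε.trans hr'.1).ne'
    refine ((((s.hasDerivAt_ell_space hεR htI hr').div_const (lam + 2 * μ)).exp.mul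
      ((hasDerivAt_id r).mul (s.hur t htI r (Ioo_subset_Icc_self hr'))))).congr_deriv ?_
    simp only [fac, ellT, id, Pi.mul_apply]
    field_simp
    ring

end Potential

end ApproxSol
/-- A function continuous on `[a, b]` and bounded on `[a, b)` is bounded on `[a, b]`. -/
lemma ContinuousOn.le_of_le_Ico {g : ℝ → ℝ} {a b c : ℝ} (hab : a < b)
    (hg : ContinuousOn g (Icc a b)) (h : ∀ r ∈ Ico a b, g r ≤ c) {r : ℝ} (hr : r ∈ Icc a b) :
    g r ≤ c := by
  rw [← closure_Ico hab.ne] at hr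
  exact le_on_closure h (by rwa [closure_Ico hab.ne]) continuousOn_const hr

namespace ApproxSol

open Function

section Paths

variable {μ lam κ K ε R T C₀ M₀ Cf : ℝ} (s : ApproxSol μ lam κ K ε R T C₀ M₀ Cf)
  (hT : 0 < T) (hε : 0 < ε) (hεR : ε < R)
include hε

lemma mass_lt_mass {t : ℝ} (ht : t ∈ Icc 0 T) {y z : ℝ} (hy : y ∈ Icc ε R) (hz : z ∈ Icc ε R)
    (hyz : y < z) : ∫ r in ε..y, s.ρ t r * r < ∫ r in ε..z, s.ρ t r * r := by
  have c := continuousOn_slice_right s.continuousOn_massDensity ht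
  have hl : ε ∈ Icc ε R := left_mem_Icc.2 (hy.1.trans hy.2)
  rw [← intervalIntegral.integral_add_adjacent_intervals (c.intervalIntegrable_sub hl hy)
    (c.intervalIntegrable_sub hy hz)]
  refine lt_add_of_pos_right _ (intervalIntegral.intervalIntegral_pos_of_pos_on
    (c.intervalIntegrable_sub hy hz) (fun r hr => ?_) hyz)
  have hrI : r ∈ Icc ε R := ⟨hy.1.trans hr.1.le, hr.2.le.trans hz.2⟩
  exact mul_pos (s.ρ_pos t ht r hrI) (hε.trans_le hrI.1)

include hT hεR

/-- Particle paths starting outside a given particle path remain outside of it. -/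
lemma exists_outer_path {x : ℝ → ℝ} {h : ℝ} (hh : 0 < h)
    (hx : ∀ t ∈ Icc 0 T, x t ∈ Icc ε R ∧ ∫ r in ε..x t, s.ρ t r * r = h) {t₀ r₀ : ℝ}
    (ht₀ : t₀ ∈ Icc 0 T) (hr₀ : r₀ ∈ Ico (x t₀) R) :
    ∃ z : ℝ → ℝ, z t₀ = r₀ ∧ (∀ t ∈ Icc 0 T, z t ∈ Icc (x t) R) ∧ (∀ t ∈ Icc 0 T, z t ∈ Ioo ε R) ∧
      ContinuousOn z (Icc 0 T) ∧ ∀ t ∈ Ioo 0 T, HasDerivAt z (s.u t (z t)) t := by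
  have hR := right_mem_Icc.2 hεR.le
  have hr₀I : r₀ ∈ Icc ε R := ⟨(hx t₀ ht₀).1.1.trans hr₀.1, hr₀.2.le⟩
  obtain ⟨z, hz₀, hz⟩ := s.exists_path hT hε hεR ht₀ hr₀I
  have hm : h ≤ ∫ r in ε..r₀, s.ρ t₀ r * r := by
    rcases hr₀.1.eq_or_lt with he | hlt
    · rw [← he, (hx t₀ ht₀).2]
    · rw [← (hx t₀ ht₀).2]
      exact (s.mass_lt_mass hε ht₀ (hx t₀ ht₀).1 hr₀I hlt).le
  have hmM : ∫ r in ε..r₀, s.ρ t₀ r * r < M₀ :=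
    (s.mass_lt_mass hε ht₀ hr₀I hR hr₀.2).trans_eq (s.integral_mass hT hε hεR ht₀)
  refine ⟨z, hz₀, fun t ht => ⟨le_of_not_gt fun hlt => ?_, (hz t ht).1.2⟩,
    fun t ht => s.path_mem_Ioo hε hεR hz hT (hh.trans_le hm) hmM ht,
    s.continuousOn_path hT hε hεR hz, fun t ht => s.hasDerivAt_path hT hε hεR hz ht⟩
  have := s.mass_lt_mass hε ht (hz t ht).1 (hx t ht).1 hlt
  rw [(hz t ht).2, (hx t ht).2] at this
  exact this.not_ge hm

end Paths

section Region

variable {μ lam κ K ε R T C₀ M₀ Cf E a : ℝ} (s : ApproxSol μ lam κ K ε R T C₀ M₀ Cf)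
  (hK : 0 < K) (hM₀ : 0 < M₀) (hT : 0 < T) (hε : 0 < ε) (hεR : ε < R) (ha : 0 < a)
include hK hT hε hεR ha

lemma abs_mom_le {t y : ℝ} (ht : t ∈ Icc 0 T) (hE : (∫ r in ε..R, s.ent t r) + M₀ ≤ E)
    (hy : y ∈ Icc ε R) (hay : a ≤ y) : |s.mom t y| ≤ E / a := by
  have cρ := continuousOn_slice_right (g := s.ρ) s.continuousOn_ρ ht
  have cu := continuousOn_slice_right (g := s.u) s.continuousOn_u ht
  have cau := cu.abs
  refine (intervalIntegral.abs_integral_le_integral_abs hy.2).trans ?_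
  have h1 : ∫ r in y..R, |s.ρ t r * s.u t r| ≤ ∫ r in y..R, a⁻¹ * (s.ρ t r * |s.u t r| * r) :=
    ContinuousOn.integral_mono_sub (cρ.mul cu).abs (by fun_prop) hy.1 hy.2 le_rfl fun r hr => by
      have hρ := s.ρ_pos t ht r ⟨hy.1.trans hr.1, hr.2⟩
      rw [abs_mul, abs_of_pos hρ, inv_mul_eq_div, le_div_iff₀ ha]
      exact mul_le_mul_of_nonneg_left (hay.trans hr.1) (by positivity)
  refine h1.trans ?_
  rw [intervalIntegral.integral_const_mul, div_eq_inv_mul]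
  refine mul_le_mul_of_nonneg_left ?_ (inv_nonneg.2 ha.le)
  refine (ContinuousOn.integral_le_integral_sub (g := fun r => s.ρ t r * |s.u t r| * r)
    (by fun_prop) (fun r hr => ?_) hy.1 hy.2 le_rfl).trans
    (s.integral_abs_momentum_le hK hT hε hεR ht hE)
  exact mul_nonneg (mul_nonneg (s.ρ_pos t ht r hr).le (abs_nonneg _)) (hε.le.trans hr.1)

include hM₀

lemma abs_src_le {t y : ℝ} (ht : t ∈ Icc 0 T) (hE : (∫ r in ε..R, s.ent t r) + M₀ ≤ E)
    (hy : y ∈ Icc ε R) (hay : a ≤ y) :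
    |s.src t y| ≤ s.forceSup t * (M₀ / a) + 2 * E / a ^ 2 := by
  have cρ := continuousOn_slice_right (g := s.ρ) s.continuousOn_ρ ht
  have cu := continuousOn_slice_right (g := s.u) s.continuousOn_u ht
  have cm := continuousOn_slice_right s.continuousOn_massDensity ht
  have ck : ContinuousOn (fun r => s.ρ t r * s.u t r ^ 2 * r) (Icc ε R) := by fun_prop
  have hl := left_mem_Icc.2 hεR.le
  have hR := right_mem_Icc.2 hεR.le
  refine (intervalIntegral.abs_integral_le_integral_abs hy.2).trans ?_
  have h1 : ∫ r in y..R, |s.ρ t r * s.f t r - s.ρ t r * s.u t r ^ 2 / r| ≤ ∫ r in y..R,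
      (s.forceSup t / a * (s.ρ t r * r) + (a ^ 2)⁻¹ * (s.ρ t r * s.u t r ^ 2 * r)) :=
    ContinuousOn.integral_mono_sub
      (continuousOn_slice_right (s.continuousOn_srcDensity hε) ht).abs (by fun_prop)
      hy.1 hy.2 le_rfl fun r hr => by
      have hrI : r ∈ Icc ε R := ⟨hy.1.trans hr.1, hr.2⟩
      have har := hay.trans hr.1
      have hr0 := ha.trans_le har
      have hρ := s.ρ_pos t ht r hrI
      have hf := s.abs_f_le_forceSup ht hrI
      refine (abs_sub _ _).trans (add_le_add ?_ ?_)
      · rw [abs_mul, abs_of_pos hρ, div_mul_eq_mul_div, le_div_iff₀ ha]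
        calc s.ρ t r * |s.f t r| * a ≤ s.ρ t r * s.forceSup t * r := by
              have := s.forceSup_nonneg t
              gcongr
          _ = _ := by ring
      · rw [abs_of_nonneg (by positivity), inv_mul_eq_div, div_le_div_iff₀ hr0 (by positivity)]
        calc s.ρ t r * s.u t r ^ 2 * a ^ 2 ≤ s.ρ t r * s.u t r ^ 2 * r ^ 2 := by gcongr
          _ = _ := by ring
  refine h1.trans ?_
  rw [intervalIntegral.integral_add ((cm.intervalIntegrable_sub hy hR).const_mul _)
    ((ck.intervalIntegrable_sub hy hR).const_mul _), intervalIntegral.integral_const_mul,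
    intervalIntegral.integral_const_mul]
  have h2 := cm.integral_le_integral_sub (fun r hr => mul_nonneg (s.ρ_pos t ht r hr).le
    (hε.le.trans hr.1)) hy.1 hy.2 le_rfl
  rw [s.integral_mass hT hε hεR ht] at h2
  have h3 := (ck.integral_le_integral_sub (fun r hr => mul_nonneg (mul_nonneg
    (s.ρ_pos t ht r hr).le (sq_nonneg _)) (hε.le.trans hr.1)) hy.1 hy.2 le_rfl).trans
    (s.integral_kinetic_le hK hT hε hεR ht hM₀ hE)
  refine add_le_add ?_ ?_
  · rw [← mul_comm_div]
    exact mul_le_mul_of_nonneg_left h2 (div_nonneg (s.forceSup_nonneg t) ha.le)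
  · rw [div_eq_inv_mul]
    exact mul_le_mul_of_nonneg_left h3 (by positivity)

end Region

end ApproxSol
namespace ApproxSol

open Function

section Region

variable {μ lam κ K ε R T C₀ M₀ Cf E a I : ℝ}

/-- The region outside the particle path `x` stays at distance `a` from the origin and keeps an
area of at least `I / 2`, while the energy is bounded by `E`. -/
structure IsOuterRegion (s : ApproxSol μ lam κ K ε R T C₀ M₀ Cf) (x : ℝ → ℝ) (E a I : ℝ) :
    Prop where
  energy : ∀ t ∈ Icc 0 T, (∫ r in ε..R, s.ent t r) + M₀ ≤ E
  mem : ∀ t ∈ Icc 0 T, x t ∈ Ioo ε R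
  cont : ContinuousOn x (Icc 0 T)
  deriv : ∀ t ∈ Ioo 0 T, HasDerivAt x (s.u t (x t)) t
  le_path : ∀ t ∈ Icc 0 T, a ≤ x t
  area : ∀ t ∈ Icc 0 T, I ≤ R ^ 2 - x t ^ 2

/-- A bound for the lower order terms in the momentum balance. -/
def srcRate (s : ApproxSol μ lam κ K ε R T C₀ M₀ Cf) (E a t : ℝ) : ℝ :=
  s.forceSup t * (M₀ / a) + 2 * E / a ^ 2

variable (s : ApproxSol μ lam κ K ε R T C₀ M₀ Cf)

lemma fac_pos (t r : ℝ) : 0 < s.fac t r := Real.exp_pos _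

lemma fac_le_of_abs_sub_le (hν : 0 < lam + 2 * μ) {t r t' r' b : ℝ}
    (h : s.ell t r - s.ell t' r' ≤ b) :
    s.fac t r ≤ Real.exp (b / (lam + 2 * μ)) * s.fac t' r' := by
  unfold fac
  rw [← Real.exp_add, ← add_div]
  gcongr
  linarith

lemma continuousOn_srcRate (hT : 0 < T) (hεR : ε < R) :
    ContinuousOn (s.srcRate E a) (Icc 0 T) :=
  ((s.continuousOn_forceSup hT hεR).mul continuousOn_const).add continuousOn_const

variable (hν : 0 < lam + 2 * μ) (hK : 0 < K) (hM₀ : 0 < M₀) (hT : 0 < T) (hε : 0 < ε)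
  (hεR : ε < R) (ha : 0 < a) (hE : 0 < E) (hI : 0 < I) {x : ℝ → ℝ}

include hM₀ ha hE in
lemma srcRate_nonneg (t : ℝ) : 0 ≤ s.srcRate E a t := by
  have := s.forceSup_nonneg t
  unfold srcRate
  positivity

include hM₀ hT hεR ha hE in
lemma integral_srcRate_le {t : ℝ} (ht : t ∈ Icc 0 T) :
    ∫ τ in (0:ℝ)..t, s.srcRate E a τ ≤ Cf * (M₀ / a) + 2 * E / a ^ 2 * T := by
  have h := (s.continuousOn_forceSup hT hεR).intervalIntegrable_sub (left_mem_Icc.2 hT.le) ht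
  unfold srcRate
  rw [intervalIntegral.integral_add (h.mul_const _) (by simp), intervalIntegral.integral_mul_const,
    intervalIntegral.integral_const, smul_eq_mul, sub_zero, mul_comm t]
  have := s.integral_forceSup_le hT hεR ht
  have := ht.2
  gcongr

namespace IsOuterRegion

variable {s} (hx : s.IsOuterRegion x E a I)
include hx

lemma mem_of_mem_Icc {t r : ℝ} (ht : t ∈ Icc 0 T) (hr : r ∈ Icc (x t) R) :
    r ∈ Icc ε R ∧ a ≤ r :=
  ⟨⟨(hx.mem t ht).1.le.trans hr.1, hr.2⟩, (hx.le_path t ht).trans hr.1⟩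

include hν hK hT hε hεR ha

lemma fac_le_fac {t r r' : ℝ} (ht : t ∈ Icc 0 T) (hr : r ∈ Icc (x t) R) (hr' : r' ∈ Icc (x t) R) :
    s.fac t r ≤ Real.exp (2 * (E / a) / (lam + 2 * μ)) * s.fac t r' := by
  obtain ⟨h1, h2⟩ := hx.mem_of_mem_Icc ht hr
  obtain ⟨h3, h4⟩ := hx.mem_of_mem_Icc ht hr'
  have h5 := abs_le.1 (s.abs_mom_le hK hT hε hεR ha ht (hx.energy t ht) h1 h2)
  have h6 := abs_le.1 (s.abs_mom_le hK hT hε hεR ha ht (hx.energy t ht) h3 h4)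
  refine s.fac_le_of_abs_sub_le hν ?_
  simp only [ell]
  linarith [h5.2, h6.1]

lemma fac_mul_le_integral {t r : ℝ} (ht : t ∈ Icc 0 T) (hr : r ∈ Icc (x t) R) :
    s.fac t r * (I / 2) ≤
      Real.exp (2 * (E / a) / (lam + 2 * μ)) * ∫ r in x t..R, s.fac t r * r := by
  have cF := continuousOn_slice_right (s.continuousOn_fac hT hεR) ht
  have hxt := hx.mem t ht
  have h := ContinuousOn.integral_mono_sub (g₁ := fun r' => s.fac t r * r')
    (g₂ := fun r' => Real.exp (2 * (E / a) / (lam + 2 * μ)) * (s.fac t r' * r')) (a := ε) (b := R)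
    (by fun_prop) (by fun_prop) hxt.1.le hxt.2.le le_rfl fun r' hr' => by
      rw [← mul_assoc]
      exact mul_le_mul_of_nonneg_right (hx.fac_le_fac hν hK hT hε hεR ha ht hr hr')
        (hε.le.trans (hx.mem_of_mem_Icc ht hr').1.1)
  rw [intervalIntegral.integral_const_mul, intervalIntegral.integral_const_mul, integral_id] at h
  refine (mul_le_mul_of_nonneg_left ?_ (s.fac_pos t r).le).trans h
  linarith [hx.area t ht]

lemma integral_le_fac_mul {t r : ℝ} (ht : t ∈ Icc 0 T) (hr : r ∈ Icc (x t) R) :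
    ∫ r in x t..R, s.fac t r * r ≤
      Real.exp (2 * (E / a) / (lam + 2 * μ)) * s.fac t r * (R ^ 2 / 2) := by
  have cF := continuousOn_slice_right (s.continuousOn_fac hT hεR) ht
  have hxt := hx.mem t ht
  have h := ContinuousOn.integral_mono_sub (g₁ := fun r' => s.fac t r' * r')
    (g₂ := fun r' => Real.exp (2 * (E / a) / (lam + 2 * μ)) * s.fac t r * r') (a := ε) (b := R)
    (by fun_prop) (by fun_prop) hxt.1.le hxt.2.le le_rfl fun r' hr' =>
      mul_le_mul_of_nonneg_right (hx.fac_le_fac hν hK hT hε hεR ha ht hr' hr)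
        (hε.le.trans (hx.mem_of_mem_Icc ht hr').1.1)
  rw [intervalIntegral.integral_const_mul, integral_id] at h
  refine h.trans (mul_le_mul_of_nonneg_left ?_
    (mul_pos (Real.exp_pos _) (s.fac_pos t r)).le)
  linarith [sq_nonneg (x t)]

lemma fac_zero_bounds (hC₀ : 1 ≤ C₀) {r : ℝ} (hr : r ∈ Icc (x 0) R) :
    s.fac 0 r ≤ C₀ * Real.exp (E / a / (lam + 2 * μ)) ∧
      C₀⁻¹ * Real.exp (-(E / a / (lam + 2 * μ))) ≤ s.fac 0 r := by
  have h0 := left_mem_Icc.2 hT.le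
  obtain ⟨h1, h2⟩ := hx.mem_of_mem_Icc h0 hr
  have h5 := abs_le.1 (s.abs_mom_le hK hT hε hεR ha h0 (hx.energy 0 h0) h1 h2)
  have hρ := s.ρ_pos 0 h0 R (right_mem_Icc.2 hεR.le)
  have hi := s.init_ρ R (right_mem_Icc.2 hεR.le)
  have hC : 0 < C₀ := zero_lt_one.trans_le hC₀
  have hF : s.fac 0 r = s.ρ 0 R * Real.exp (s.mom 0 r / (lam + 2 * μ)) := by
    simp only [fac, ell, intervalIntegral.integral_same, add_zero]
    rw [add_div, Real.exp_add, mul_div_cancel_left₀ _ hν.ne', Real.exp_log hρ]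
  rw [hF]
  constructor
  · have := h5.2
    gcongr
    exact hi.2
  · have := h5.1
    rw [← neg_div]
    gcongr
    exact hi.1

include hM₀

omit hν in
lemma abs_src_le_srcRate {t r : ℝ} (ht : t ∈ Icc 0 T) (hr : r ∈ Icc (x t) R) :
    |s.src t r| ≤ s.srcRate E a t := by
  obtain ⟨h1, h2⟩ := hx.mem_of_mem_Icc ht hr
  exact s.abs_src_le hK hM₀ hT hε hεR ha ht (hx.energy t ht) h1 h2

include hE hI

lemma integral_fac_bounds {t : ℝ} (ht : t ∈ Icc 0 T) :
    (∫ r in x t..R, s.fac t r * r) ≤ (∫ r in x 0..R, s.fac 0 r * r) * Real.exp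
      ((Cf * (M₀ / a) + 2 * E / a ^ 2 * T
        + 2 / I * Real.exp (2 * (E / a) / (lam + 2 * μ)) * (K * (2 * E)) * T) / (lam + 2 * μ)) ∧
    (∫ r in x 0..R, s.fac 0 r * r) *
      Real.exp (-((Cf * (M₀ / a) + 2 * E / a ^ 2 * T) / (lam + 2 * μ)))
        ≤ ∫ r in x t..R, s.fac t r * r := by
  set c := Real.exp (2 * (E / a) / (lam + 2 * μ)) with hc
  set ν := lam + 2 * μ with hνdef
  have c0 : ContinuousOn (uncurry fun t r => s.fac t r * r) (Icc 0 T ×ˢ Icc ε R) :=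
    (s.continuousOn_fac hT hεR).mul continuous_snd.continuousOn
  have hy : ContinuousOn (fun τ => ∫ r in x τ..R, s.fac τ r * r) (Icc 0 T) :=
    continuousOn_comp_path (continuousOn_integral_upper hT.le hεR.le c0) hx.cont
      fun t ht => Ioo_subset_Icc_self (hx.mem t ht)
  have hd : ∀ τ ∈ Ioo 0 T, HasDerivAt (fun τ => ∫ r in x τ..R, s.fac τ r * r)
      (∫ r in x τ..R, s.fac τ r * r * ((s.pres τ r + s.src τ r) / ν)) τ := fun τ hτ =>
    s.hasDerivAt_integral_fac hT hε hεR hν.ne' hτ (hx.mem τ (Ioo_subset_Icc_self hτ))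
      (hx.deriv τ hτ)
  have hg := s.continuousOn_srcRate (E := E) (a := a) hT hεR
  have hA0 : ∀ τ ∈ Icc 0 T, 0 ≤ ∫ r in x τ..R, s.fac τ r * r := fun τ hτ =>
    intervalIntegral.integral_nonneg (hx.mem τ hτ).2.le fun r hr =>
      mul_nonneg (s.fac_pos τ r).le (hε.le.trans (hx.mem_of_mem_Icc hτ hr).1.1)
  have h0 := left_mem_Icc.2 hT.le
  have hint := s.integral_srcRate_le hM₀ hT hεR ha hE ht
  have cd : ∀ τ ∈ Icc 0 T,
      ContinuousOn (fun r => s.fac τ r * r * ((s.pres τ r + s.src τ r) / ν)) (Icc ε R) := by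
    intro τ hτ
    have cF := continuousOn_slice_right (s.continuousOn_fac hT hεR) hτ
    have cP := continuousOn_slice_right s.continuousOn_pres hτ
    have cS := continuousOn_slice_right (s.continuousOn_src hT hε hεR) hτ
    fun_prop
  constructor
  · refine (gronwall_le (α := fun τ => (s.srcRate E a τ + 2 / I * c * (K * (2 * E))) / ν) hy
      ((hg.add continuousOn_const).div_const _) hd (fun τ hτ => ?_) ht).trans ?_
    · have hτI := Ioo_subset_Icc_self hτ
      have hxt := hx.mem τ hτI
      have cF := continuousOn_slice_right (s.continuousOn_fac hT hεR) hτI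
      have cρ := continuousOn_slice_right (g := s.ρ) s.continuousOn_ρ hτI
      have cθ := continuousOn_slice_right (g := s.θ) s.continuousOn_θ hτI
      have cm := continuousOn_slice_right c0 hτI
      have cθm : ContinuousOn (fun r => s.ρ τ r * s.θ τ r * r) (Icc ε R) := by fun_prop
      set A := ∫ r in x τ..R, s.fac τ r * r with hA
      have hxI := Ioo_subset_Icc_self hxt
      have hRI := right_mem_Icc.2 hεR.le
      have h := (cd τ hτI).integral_mono_sub
        (g₂ := fun r => s.srcRate E a τ / ν * (s.fac τ r * r)
          + 2 / I * c * A * (K / ν) * (s.ρ τ r * s.θ τ r * r)) (by fun_prop) hxt.1.le hxt.2.le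
          le_rfl fun r hr => by
            have hr' := hx.mem_of_mem_Icc hτI hr
            have hr0 : 0 < r := hε.trans_le hr'.1.1
            have h1 := (abs_le.1 (hx.abs_src_le_srcRate hK hM₀ hT hε hεR ha hτI hr)).2
            have h2 : s.fac τ r ≤ 2 / I * c * A := by
              have := hx.fac_mul_le_integral hν hK hT hε hεR ha hτI hr
              rw [div_mul_eq_mul_div, div_mul_eq_mul_div, le_div_iff₀ hI]
              linarith
            have hρ := s.ρ_pos τ hτI r hr'.1
            have hθ := s.θ_pos τ hτI r hr'.1
            have hF := s.fac_pos τ r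
            calc s.fac τ r * r * ((s.pres τ r + s.src τ r) / ν)
                = s.src τ r / ν * (s.fac τ r * r)
                  + s.fac τ r * (K / ν) * (s.ρ τ r * s.θ τ r * r) := by unfold pres; ring
              _ ≤ _ := by gcongr
      rw [intervalIntegral.integral_add ((cm.intervalIntegrable_sub hxI hRI).const_mul _)
        ((cθm.intervalIntegrable_sub hxI hRI).const_mul _), intervalIntegral.integral_const_mul,
        intervalIntegral.integral_const_mul] at h
      have h3 := (cθm.integral_le_integral_sub (fun r hr => mul_nonneg (mul_nonneg
        (s.ρ_pos τ hτI r hr).le (s.θ_pos τ hτI r hr).le) (hε.le.trans hr.1)) hxt.1.le hxt.2.le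
        le_rfl).trans (s.integral_thermal_le hK hT hε hεR hτI (hx.energy τ hτI))
      have hA' := hA0 τ hτI
      calc _ ≤ _ := h
        _ ≤ s.srcRate E a τ / ν * A + 2 / I * c * A * (K / ν) * (2 * E) := by gcongr
        _ = _ := by ring
    · refine mul_le_mul_of_nonneg_left (Real.exp_le_exp.2 ?_) (hA0 0 h0)
      rw [intervalIntegral.integral_div, intervalIntegral.integral_add
        (hg.intervalIntegrable_sub h0 ht) (by simp), intervalIntegral.integral_const, smul_eq_mul,
        sub_zero, mul_comm t]
      have := ht.2
      gcongr
  · refine le_trans ?_ (le_gronwall (α := fun τ => s.srcRate E a τ / ν) hy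
      (hg.div_const _) hd (fun τ hτ => ?_) ht)
    · refine mul_le_mul_of_nonneg_left (Real.exp_le_exp.2 ?_) (hA0 0 h0)
      rw [intervalIntegral.integral_div]
      gcongr
    · have hτI := Ioo_subset_Icc_self hτ
      have hxt := hx.mem τ hτI
      have cm := continuousOn_slice_right c0 hτI
      rw [← intervalIntegral.integral_const_mul]
      refine ContinuousOn.integral_mono_sub (g₁ := fun r => -(s.srcRate E a τ / ν) *
        (s.fac τ r * r)) (continuousOn_const.mul cm) (cd τ hτI) hxt.1.le hxt.2.le le_rfl
        fun r hr => ?_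
      have hr' := hx.mem_of_mem_Icc hτI hr
      have hr0 : 0 < r := hε.trans_le hr'.1.1
      have h1 := (abs_le.1 (hx.abs_src_le_srcRate hK hM₀ hT hε hεR ha hτI hr)).1
      have hρ := s.ρ_pos τ hτI r hr'.1
      have hθ := s.θ_pos τ hτI r hr'.1
      have hF := s.fac_pos τ r
      have hP : 0 ≤ s.pres τ r := by unfold pres; positivity
      rw [mul_comm, ← neg_div]
      gcongr
      linarith

end IsOuterRegion

/-- Uniform bounds for the integrating factor in an outer region. -/
lemma exists_fac_bounds (hν : 0 < lam + 2 * μ) (hK : 0 < K) (hM₀ : 0 < M₀) (hT : 0 < T)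
    (hC₀ : 1 ≤ C₀) (hR : 0 < R) (ha : 0 < a) (hE : 0 < E) (hI : 0 < I) :
    ∃ B₁ > 0, ∃ B₂ > 0, ∀ ε : ℝ, 0 < ε → ε < R → ∀ s : ApproxSol μ lam κ K ε R T C₀ M₀ Cf,
      ∀ x : ℝ → ℝ, s.IsOuterRegion x E a I → ∀ t ∈ Icc 0 T, ∀ r ∈ Icc (x t) R,
        B₁ ≤ s.fac t r ∧ s.fac t r ≤ B₂ := by
  have hC : 0 < C₀ := zero_lt_one.trans_le hC₀
  set c := Real.exp (2 * (E / a) / (lam + 2 * μ)) with hc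
  set d := Real.exp (E / a / (lam + 2 * μ)) with hd
  set e₁ := Real.exp ((Cf * (M₀ / a) + 2 * E / a ^ 2 * T
        + 2 / I * c * (K * (2 * E)) * T) / (lam + 2 * μ)) with he₁
  set e₂ := Real.exp (-((Cf * (M₀ / a) + 2 * E / a ^ 2 * T) / (lam + 2 * μ))) with he₂
  have hc0 : 0 < c := Real.exp_pos _
  have hd0 : 0 < d := Real.exp_pos _
  have he₁0 : 0 < e₁ := Real.exp_pos _
  have he₂0 : 0 < e₂ := Real.exp_pos _
  refine ⟨C₀⁻¹ * d⁻¹ * (I / 2) / c * e₂ / (c * (R ^ 2 / 2)), by positivity,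
    c * (c * (C₀ * d) * (R ^ 2 / 2) * e₁) / (I / 2), by positivity, ?_⟩
  intro ε hε hεR s x hx t ht r hr
  have h0 := left_mem_Icc.2 hT.le
  have hR0 : R ∈ Icc (x 0) R := right_mem_Icc.2 (hx.mem 0 h0).2.le
  obtain ⟨h1, h2⟩ := hx.integral_fac_bounds hν hK hM₀ hT hε hεR ha hE hI ht
  obtain ⟨h3, h4⟩ := hx.fac_zero_bounds hν hK hT hε hεR ha hC₀ hR0
  rw [Real.exp_neg] at h4
  have h5 := hx.fac_mul_le_integral hν hK hT hε hεR ha h0 hR0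
  have h6 := hx.integral_le_fac_mul hν hK hT hε hεR ha h0 hR0
  have h7 := hx.fac_mul_le_integral hν hK hT hε hεR ha ht hr
  have h8 := hx.integral_le_fac_mul hν hK hT hε hεR ha ht hr
  constructor
  · rw [div_le_iff₀ (by positivity)]
    calc C₀⁻¹ * d⁻¹ * (I / 2) / c * e₂ ≤ s.fac 0 R * (I / 2) / c * e₂ := by gcongr
      _ ≤ (∫ r in x 0..R, s.fac 0 r * r) * e₂ := by
        gcongr
        rw [div_le_iff₀ hc0, mul_comm _ c]
        exact h5
      _ ≤ _ := h2
      _ ≤ _ := h8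
      _ = _ := by ring
  · rw [le_div_iff₀ (by positivity)]
    calc s.fac t r * (I / 2) ≤ _ := h7
      _ ≤ c * ((∫ r in x 0..R, s.fac 0 r * r) * e₁) := by gcongr
      _ ≤ c * (c * s.fac 0 R * (R ^ 2 / 2) * e₁) := by gcongr
      _ ≤ _ := by gcongr

end Region

end ApproxSol
lemma sub_le_integral_abs_deriv {f f' : ℝ → ℝ} {a b p q : ℝ} (hf' : ContinuousOn f' (Icc a b))
    (hd : ∀ r ∈ Icc a b, HasDerivAt f (f' r) r) (hp : p ∈ Icc a b) (hq : q ∈ Icc a b) :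
    f p - f q ≤ ∫ r in a..b, |f' r| := by
  have key : ∀ p ∈ Icc a b, ∀ q ∈ Icc a b, p ≤ q → |f q - f p| ≤ ∫ r in a..b, |f' r| := by
    intro p hp q hq hpq
    rw [← intervalIntegral.integral_eq_sub_of_hasDerivAt
      (fun r hr => hd r (uIcc_subset_Icc hp hq hr)) (hf'.intervalIntegrable_sub hp hq)]
    exact (intervalIntegral.abs_integral_le_integral_abs hpq).trans
      (hf'.abs.integral_le_integral_sub (fun _ _ => abs_nonneg _) hp.1 hpq hq.2)
  rcases le_total p q with h | h
  · exact ((le_abs_self _).trans_eq (abs_sub_comm _ _)).trans (key p hp q hq h)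
  · exact (le_abs_self _).trans (key q hq p hp h)

namespace ApproxSol

open Function

section Temperature

variable {μ lam κ K ε R T C₀ M₀ Cf E : ℝ} (s : ApproxSol μ lam κ K ε R T C₀ M₀ Cf)
  (hK : 0 < K) (hT : 0 < T) (hε : 0 < ε) (hεR : ε < R)
include hK hT hε hεR

/-- A pointwise bound for the temperature by the heat dissipation. -/
lemma temperature_le {t : ℝ} (ht : t ∈ Icc 0 T) (hE : (∫ r in ε..R, s.ent t r) + M₀ ≤ E)
    {y m X : ℝ} (hy : y ∈ Icc ε R) (hm : 0 < m) (hmass : ∫ r in y..R, s.ρ t r * r = m) (hX : 0 < X)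
    (hXθ : ∫ r in y..R, s.θ t r / r ≤ X) {r : ℝ} (hr : r ∈ Icc y R) :
    s.θ t r ≤ 2 * (2 * E / m) + X * s.heatDiss t := by
  have cρ := continuousOn_slice_right (g := s.ρ) s.continuousOn_ρ ht
  have cθ := continuousOn_slice_right (g := s.θ) s.continuousOn_θ ht
  have cθr := continuousOn_slice_right (g := s.θr) (s.continuousOn_θr hT hεR) ht
  have cm := continuousOn_slice_right s.continuousOn_massDensity ht
  have cV := continuousOn_slice_right (s.continuousOn_heatDensity hT hεR) ht
  have cθm : ContinuousOn (fun r => s.ρ t r * s.θ t r * r) (Icc ε R) := by fun_prop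
  have cq : ContinuousOn (fun r => s.θ t r / r) (Icc ε R) :=
    cθ.div continuousOn_id fun r hr => (hε.trans_le hr.1).ne'
  have hsub : Icc y R ⊆ Icc ε R := Icc_subset_Icc_left hy.1
  have hRI := right_mem_Icc.2 hεR.le
  have hne : (Icc y R).Nonempty := nonempty_Icc.2 hy.2
  obtain ⟨p, hp, hpmax⟩ := isCompact_Icc.exists_isMaxOn hne (cθ.mono hsub)
  obtain ⟨q, hq, hqmin⟩ := isCompact_Icc.exists_isMinOn hne (cθ.mono hsub)
  have hmin : s.θ t q ≤ 2 * E / m := by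
    rw [le_div_iff₀ hm, ← hmass, ← intervalIntegral.integral_const_mul]
    refine (ContinuousOn.integral_mono_sub (g₁ := fun r => s.θ t q * (s.ρ t r * r))
      (continuousOn_const.mul cm) cθm hy.1 hy.2 le_rfl fun r hr => ?_).trans
      ((cθm.integral_le_integral_sub (fun r hr => mul_nonneg (mul_nonneg (s.ρ_pos t ht r hr).le
        (s.θ_pos t ht r hr).le) (hε.le.trans hr.1)) hy.1 hy.2 le_rfl).trans
        (s.integral_thermal_le hK hT hε hεR ht hE))
    have h1 : s.θ t q * (s.ρ t r * r) ≤ s.θ t r * (s.ρ t r * r) :=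
      mul_le_mul_of_nonneg_right (hqmin hr) (mul_nonneg (s.ρ_pos t ht r (hsub hr)).le
      (hε.le.trans (hsub hr).1))
    linarith
  have hosc := sub_le_integral_abs_deriv (cθr.mono hsub) (fun r hr => s.hθr t ht r (hsub hr)) hp hq
  have hP := s.θ_pos t ht p (hsub hp)
  have hbd := cθr.abs.integral_mono_sub
    (g₂ := fun r => X / 2 * ((s.θr t r / s.θ t r) ^ 2 * r) + s.θ t p / (2 * X) * (s.θ t r / r))
    ((continuousOn_const.mul cV).add (continuousOn_const.mul cq)) hy.1 hy.2 le_rfl fun r hr => by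
      have hθ := s.θ_pos t ht r (hsub hr)
      have hr0 := hε.trans_le (hsub hr).1
      have h1 : |s.θr t r| ≤ X / 2 * ((s.θr t r / s.θ t r) ^ 2 * r)
          + s.θ t r / (2 * X) * (s.θ t r / r) := by
        rw [← sq_abs, abs_div, abs_of_pos hθ]
        set w := |s.θr t r|
        have h2 : X / 2 * ((w / s.θ t r) ^ 2 * r) + s.θ t r / (2 * X) * (s.θ t r / r) - w
            = (X * r * w - s.θ t r ^ 2) ^ 2 / (2 * X * r * s.θ t r ^ 2) := by
          field_simp
          ring
        have h3 : 0 ≤ (X * r * w - s.θ t r ^ 2) ^ 2 / (2 * X * r * s.θ t r ^ 2) := by positivity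
        linarith
      refine h1.trans (add_le_add le_rfl ?_)
      have h4 : s.θ t r ≤ s.θ t p := hpmax hr
      gcongr
  rw [intervalIntegral.integral_add ((cV.intervalIntegrable_sub hy hRI).const_mul _)
    ((cq.intervalIntegrable_sub hy hRI).const_mul _), intervalIntegral.integral_const_mul,
    intervalIntegral.integral_const_mul] at hbd
  have hV : ∫ r in y..R, (s.θr t r / s.θ t r) ^ 2 * r ≤ s.heatDiss t :=
    cV.integral_le_integral_sub (fun r hr => mul_nonneg (sq_nonneg _) (hε.le.trans hr.1)) hy.1 hy.2
      le_rfl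
  have h5 : X / 2 * ∫ r in y..R, (s.θr t r / s.θ t r) ^ 2 * r ≤ X / 2 * s.heatDiss t := by gcongr
  have h6 : s.θ t p / (2 * X) * ∫ r in y..R, s.θ t r / r ≤ s.θ t p / (2 * X) * X := by gcongr
  have h7 : s.θ t p / (2 * X) * X = s.θ t p / 2 := by field_simp
  have h8 : s.θ t r ≤ s.θ t p := hpmax hr
  linarith

end Temperature

section Volume

variable {μ lam κ K ε R T C₀ M₀ Cf E a I : ℝ} (s : ApproxSol μ lam κ K ε R T C₀ M₀ Cf)

/-- The specific volume, weighted by the integrating factor. -/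
def vol (t r : ℝ) : ℝ := s.fac t r / s.ρ t r

lemma continuousOn_vol (hT : 0 < T) (hεR : ε < R) :
    ContinuousOn (uncurry s.vol) (Icc 0 T ×ˢ Icc ε R) :=
  (s.continuousOn_fac hT hεR).div s.continuousOn_ρ fun p hp => (s.ρ_pos p.1 hp.1 p.2 hp.2).ne'

lemma vol_pos {t r : ℝ} (ht : t ∈ Icc 0 T) (hr : r ∈ Icc ε R) : 0 < s.vol t r :=
  div_pos (s.fac_pos t r) (s.ρ_pos t ht r hr)

lemma hasDerivAt_vol (hν : lam + 2 * μ ≠ 0) (hT : 0 < T) (hε : 0 < ε) (hεR : ε < R) {z : ℝ → ℝ}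
    (hz : ∀ t ∈ Icc 0 T, z t ∈ Ioo ε R) {t : ℝ} (ht : t ∈ Ioo 0 T)
    (hzd : HasDerivAt z (s.u t (z t)) t) :
    HasDerivAt (fun τ => s.vol τ (z τ))
      (s.vol t (z t) * ((s.pres t (z t) + s.src t (z t)) / (lam + 2 * μ))) t := by
  have hexp : ∀ τ ∈ Ioo 0 T, s.vol τ (z τ) = Real.exp
      ((s.ell τ (z τ) - (lam + 2 * μ) * Real.log (s.ρ τ (z τ))) / (lam + 2 * μ)) := by
    intro τ hτ
    have hτI := Ioo_subset_Icc_self hτ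
    rw [sub_div, Real.exp_sub, mul_div_cancel_left₀ _ hν,
      Real.exp_log (s.ρ_pos τ hτI _ (Ioo_subset_Icc_self (hz τ hτI)))]
    rfl
  have h := ((s.hasDerivAt_ell_sub_log hT hε hεR ht (hz t (Ioo_subset_Icc_self ht))
    hzd).div_const (lam + 2 * μ)).exp
  rw [← hexp t ht] at h
  refine h.congr_of_eventuallyEq ?_
  filter_upwards [Ioo_mem_nhds ht.1 ht.2] with τ hτ using hexp τ hτ

/-- Uniform upper bound for the density in an outer region. -/
lemma exists_density_le (hν : 0 < lam + 2 * μ) (hK : 0 < K) (hM₀ : 0 < M₀) (hT : 0 < T)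
    (hC₀ : 1 ≤ C₀) (ha : 0 < a) (hE : 0 < E) {B₁ B₂ h : ℝ} (hB₁ : 0 < B₁) (hB₂ : 0 < B₂)
    (hh : 0 < h) :
    ∃ B₃ > 0, ∀ ε : ℝ, 0 < ε → ε < R → ∀ s : ApproxSol μ lam κ K ε R T C₀ M₀ Cf,
      ∀ x : ℝ → ℝ, s.IsOuterRegion x E a I →
      (∀ t ∈ Icc 0 T, x t ∈ Icc ε R ∧ ∫ r in ε..x t, s.ρ t r * r = h) →
      (∀ t ∈ Icc 0 T, ∀ r ∈ Icc (x t) R, B₁ ≤ s.fac t r ∧ s.fac t r ≤ B₂) →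
      ∀ t ∈ Icc 0 T, ∀ r ∈ Icc (x t) R, s.ρ t r ≤ B₃ := by
  have hC : 0 < C₀ := zero_lt_one.trans_le hC₀
  set e := Real.exp (-((Cf * (M₀ / a) + 2 * E / a ^ 2 * T) / (lam + 2 * μ))) with he
  have he0 : 0 < e := Real.exp_pos _
  refine ⟨B₂ / (B₁ / C₀ * e), by positivity, ?_⟩
  intro ε hε hεR s x hx hxh hF t ht r hr
  have h0 := left_mem_Icc.2 hT.le
  refine ContinuousOn.le_of_le_Ico (g := s.ρ t) (hx.mem t ht).2 ((continuousOn_slice_right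
    (g := s.ρ) s.continuousOn_ρ ht).mono (Icc_subset_Icc_left (hx.mem t ht).1.le))
    (fun r hr => ?_) hr
  obtain ⟨z, hz₀, hzx, hzm, hzc, hzd⟩ := s.exists_outer_path hT hε hεR hh hxh ht hr
  have hv := le_gronwall (α := fun τ => s.srcRate E a τ / (lam + 2 * μ))
    (continuousOn_comp_path (s.continuousOn_vol hT hεR) hzc
      fun t ht => Ioo_subset_Icc_self (hzm t ht))
    ((s.continuousOn_srcRate (E := E) (a := a) hT hεR).div_const _)
    (fun τ hτ => s.hasDerivAt_vol hν.ne' hT hε hεR hzm hτ (hzd τ hτ))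
    (fun τ hτ => by
      have hτI := Ioo_subset_Icc_self hτ
      have hzI := Ioo_subset_Icc_self (hzm τ hτI)
      have h1 := (abs_le.1 (hx.abs_src_le_srcRate hK hM₀ hT hε hεR ha hτI (hzx τ hτI))).1
      have h2 := s.ρ_pos τ hτI _ hzI
      have h3 := s.θ_pos τ hτI _ hzI
      have h4 := s.vol_pos hτI hzI
      have hP : 0 ≤ s.pres τ (z τ) := by unfold pres; positivity
      rw [mul_comm, ← neg_div]
      gcongr
      linarith) ht
  have hzr : z t ∈ Icc (x t) R := hzx t ht
  rw [intervalIntegral.integral_div, hz₀] at hv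
  rw [hz₀] at hzr
  have hρ := s.ρ_pos t ht r (hx.mem_of_mem_Icc ht hzr).1
  have hz0I := Ioo_subset_Icc_self (hzm 0 h0)
  have h1 : B₁ / C₀ ≤ s.vol 0 (z 0) := by
    have h2 := (hF 0 h0 (z 0) (hzx 0 h0)).1
    have h3 := (s.init_ρ (z 0) hz0I).2
    have h4 := s.ρ_pos 0 h0 _ hz0I
    have h5 := s.fac_pos 0 (z 0)
    unfold vol
    gcongr
  have h2 : e ≤ Real.exp (-((∫ τ in (0:ℝ)..t, s.srcRate E a τ) / (lam + 2 * μ))) := by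
    have := s.integral_srcRate_le hM₀ hT hεR ha hE ht
    rw [he]
    gcongr
  have h3 : s.vol t r ≤ B₂ / s.ρ t r := by
    have := (hF t ht r hzr).2
    unfold vol
    gcongr
  rw [le_div_iff₀ (by positivity), mul_comm]
  rw [← le_div_iff₀ hρ]
  have := s.vol_pos h0 hz0I
  calc B₁ / C₀ * e ≤ s.vol 0 (z 0) * Real.exp _ := mul_le_mul h1 h2 he0.le this.le
    _ ≤ _ := hv
    _ ≤ _ := h3

end Volume

end ApproxSol
namespace ApproxSol

open Function

section Bounds

variable {μ lam κ K ε R T C₀ M₀ Cf E a I : ℝ}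

lemma integral_outer_mass (s : ApproxSol μ lam κ K ε R T C₀ M₀ Cf) (hT : 0 < T) (hε : 0 < ε)
    (hεR : ε < R) {t y h : ℝ} (ht : t ∈ Icc 0 T) (hy : y ∈ Icc ε R)
    (hmass : ∫ r in ε..y, s.ρ t r * r = h) : ∫ r in y..R, s.ρ t r * r = M₀ - h := by
  have cm := continuousOn_slice_right s.continuousOn_massDensity ht
  have h1 := intervalIntegral.integral_add_adjacent_intervals
    (cm.intervalIntegrable_sub (left_mem_Icc.2 hεR.le) hy)
    (cm.intervalIntegrable_sub hy (right_mem_Icc.2 hεR.le))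
  linarith [s.integral_mass hT hε hεR ht]

lemma IsOuterRegion.temperature_le_of_vol_le {s : ApproxSol μ lam κ K ε R T C₀ M₀ Cf}
    {x : ℝ → ℝ} (hx : s.IsOuterRegion x E a I) (hK : 0 < K) (hT : 0 < T) (hε : 0 < ε)
    (hεR : ε < R) (ha : 0 < a) (hE : 0 < E) {B m N t : ℝ} (hB : 0 < B) (hm : 0 < m) (hN : 0 < N)
    (ht : t ∈ Icc 0 T) (hmass : ∫ r in x t..R, s.ρ t r * r = m)
    (hF : ∀ r ∈ Icc (x t) R, B ≤ s.fac t r) (hV : ∀ r ∈ Icc (x t) R, s.vol t r ≤ N)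
    {r : ℝ} (hr : r ∈ Icc (x t) R) :
    s.θ t r ≤ 4 * E / m + 2 * E / (B * a ^ 2) * N * s.heatDiss t := by
  have cρ := continuousOn_slice_right (g := s.ρ) s.continuousOn_ρ ht
  have cθ := continuousOn_slice_right (g := s.θ) s.continuousOn_θ ht
  have cθm : ContinuousOn (fun r => s.ρ t r * s.θ t r * r) (Icc ε R) := by fun_prop
  have cq : ContinuousOn (fun r => s.θ t r / r) (Icc ε R) :=
    cθ.div continuousOn_id fun r hr => (hε.trans_le hr.1).ne'
  have hxt := hx.mem t ht
  have hX : ∫ r in x t..R, s.θ t r / r ≤ 2 * E / (B * a ^ 2) * N := by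
    refine (ContinuousOn.integral_mono_sub
      (g₂ := fun r => N / (B * a ^ 2) * (s.ρ t r * s.θ t r * r)) cq (by fun_prop)
      hxt.1.le hxt.2.le le_rfl fun r hr => ?_).trans ?_
    · obtain ⟨h1, h2⟩ := hx.mem_of_mem_Icc ht hr
      have h3 := s.ρ_pos t ht r h1
      have h4 := s.θ_pos t ht r h1
      have h5 := hV r hr
      have h6 := hF r hr
      have hr0 := hε.trans_le h1.1
      rw [vol, div_le_iff₀ h3] at h5
      have h7 : B * a ^ 2 ≤ N * s.ρ t r * r ^ 2 := by
        have := h6.trans h5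
        gcongr
      calc s.θ t r / r = B * a ^ 2 * (s.θ t r / (r * (B * a ^ 2))) := by field_simp
        _ ≤ N * s.ρ t r * r ^ 2 * (s.θ t r / (r * (B * a ^ 2))) := by gcongr
        _ = _ := by field_simp
    · rw [intervalIntegral.integral_const_mul]
      have h1 := (cθm.integral_le_integral_sub (fun r hr => mul_nonneg (mul_nonneg
        (s.ρ_pos t ht r hr).le (s.θ_pos t ht r hr).le) (hε.le.trans hr.1)) hxt.1.le hxt.2.le
        le_rfl).trans (s.integral_thermal_le hK hT hε hεR ht (hx.energy t ht))
      calc _ ≤ N / (B * a ^ 2) * (2 * E) := by gcongr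
        _ = _ := by ring
  have := s.temperature_le hK hT hε hεR ht (hx.energy t ht) (Ioo_subset_Icc_self hxt) hm hmass
    (by positivity) hX hr
  convert this using 2
  ring

/-- Uniform upper bound for the weighted specific volume in an outer region. -/
lemma exists_vol_le (hν : 0 < lam + 2 * μ) (hK : 0 < K) (hM₀ : 0 < M₀) (hT : 0 < T)
    (hC₀ : 1 ≤ C₀) (ha : 0 < a) (hE : 0 < E) {B₁ B₂ B₃ D h : ℝ} (hB₁ : 0 < B₁) (hB₂ : 0 < B₂)
    (hB₃ : 0 < B₃) (hh : 0 < h) (hhM : h < M₀) :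
    ∃ B₄ > 0, ∀ ε : ℝ, 0 < ε → ε < R → ∀ s : ApproxSol μ lam κ K ε R T C₀ M₀ Cf,
      ∀ x : ℝ → ℝ, s.IsOuterRegion x E a I →
      (∀ t ∈ Icc 0 T, x t ∈ Icc ε R ∧ ∫ r in ε..x t, s.ρ t r * r = h) →
      (∀ t ∈ Icc 0 T, ∀ r ∈ Icc (x t) R, B₁ ≤ s.fac t r ∧ s.fac t r ≤ B₂) →
      (∀ t ∈ Icc 0 T, ∀ r ∈ Icc (x t) R, s.ρ t r ≤ B₃) →
      (∀ t ∈ Icc 0 T, ∫ τ in (0:ℝ)..t, s.heatDiss τ ≤ D) →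
      ∀ t ∈ Icc 0 T, ∀ r ∈ Icc (x t) R, s.vol t r ≤ B₄ := by
  have hC : 0 < C₀ := zero_lt_one.trans_le hC₀
  have hm : 0 < M₀ - h := sub_pos.2 hhM
  set ν := lam + 2 * μ with hνdef
  set c₁ := K * B₂ * (4 * E / (M₀ - h)) / (B₁ / B₃) / ν with hc₁
  set c₂ := K * B₂ * (2 * E / (B₁ * a ^ 2)) / ν with hc₂
  have hc₁0 : 0 < c₁ := by positivity
  have hc₂0 : 0 < c₂ := by positivity
  refine ⟨B₂ * C₀ * Real.exp ((Cf * (M₀ / a) + 2 * E / a ^ 2 * T) / ν + T * c₁ + c₂ * D),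
    by positivity, ?_⟩
  intro ε hε hεR s x hx hxh hF hρ hD
  have h0 := left_mem_Icc.2 hT.le
  set N : ℝ → ℝ := fun t => ⨆ r : Icc (x t) R, s.vol t r
  set α : ℝ → ℝ := fun t => s.srcRate E a t / ν + c₁ + c₂ * s.heatDiss t
  have cV := s.continuousOn_vol hT hεR
  have cN : ContinuousOn N (Icc 0 T) :=
    continuousOn_iSup_Icc hT.le hεR.le cV (fun t ht => (hxh t ht).1) hx.cont
  have cS := s.continuousOn_srcRate (E := E) (a := a) hT hεR
  have cH := s.continuousOn_heatDiss hT hεR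
  have cα : ContinuousOn α (Icc 0 T) :=
    ((cS.div_const _).add continuousOn_const).add (continuousOn_const.mul cH)
  have cVx : ∀ t ∈ Icc 0 T, ContinuousOn (s.vol t) (Icc (x t) R) := fun t ht =>
    (continuousOn_slice_right cV ht).mono (Icc_subset_Icc_left (hx.mem t ht).1.le)
  have hle : ∀ t ∈ Icc 0 T, ∀ r ∈ Icc (x t) R, s.vol t r ≤ N t := fun t ht r hr =>
    le_ciSup (bddAbove_range_Icc (cVx t ht)) (⟨r, hr⟩ : Icc (x t) R)
  have hlow : ∀ t ∈ Icc 0 T, B₁ / B₃ ≤ N t := fun t ht => by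
    have hR := right_mem_Icc.2 (hx.mem t ht).2.le
    refine le_trans ?_ (hle t ht R hR)
    have h1 := (hF t ht R hR).1
    have h2 := hρ t ht R hR
    have h3 := s.ρ_pos t ht R (right_mem_Icc.2 hεR.le)
    have h4 := s.fac_pos t R
    unfold vol
    gcongr
  have hNpos : ∀ t ∈ Icc 0 T, 0 < N t := fun t ht => (by positivity : 0 < B₁ / B₃).trans_le
    (hlow t ht)
  have hα0 : ∀ t ∈ Icc 0 T, 0 ≤ α t := fun t _ => by
    have h1 := s.srcRate_nonneg (E := E) hM₀ ha hE t
    have h2 := s.heatDiss_nonneg hε hεR t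
    positivity
  have hrate : ∀ t ∈ Icc 0 T, ∀ r ∈ Icc (x t) R,
      s.vol t r * ((s.pres t r + s.src t r) / ν) ≤ α t * N t := by
    intro t ht r hr
    have hrI := (hx.mem_of_mem_Icc ht hr).1
    have h1 := hx.temperature_le_of_vol_le hK hT hε hεR ha hE hB₁ hm (hNpos t ht) ht
      (s.integral_outer_mass hT hε hεR ht (hxh t ht).1 (hxh t ht).2)
      (fun r hr => (hF t ht r hr).1) (hle t ht) hr
    have h2 := (abs_le.1 (hx.abs_src_le_srcRate hK hM₀ hT hε hεR ha ht hr)).2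
    have h3 := hle t ht r hr
    have h4 := s.vol_pos ht hrI
    have h5 := s.ρ_pos t ht r hrI
    have h6 := s.θ_pos t ht r hrI
    have h7 := s.srcRate_nonneg (E := E) hM₀ ha hE t
    have h8 := (hF t ht r hr).2
    have h9 : s.vol t r * s.pres t r ≤ K * B₂ * (4 * E / (M₀ - h) / (B₁ / B₃) * N t
        + 2 * E / (B₁ * a ^ 2) * N t * s.heatDiss t) := by
      calc s.vol t r * s.pres t r = K * s.fac t r * s.θ t r := by
            unfold vol pres
            field_simp
        _ ≤ K * B₂ * s.θ t r := by gcongr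
        _ ≤ _ := by
          gcongr
          refine h1.trans (add_le_add ?_ le_rfl)
          rw [div_mul_eq_mul_div, le_div_iff₀ (by positivity)]
          have := hlow t ht
          gcongr
    have h10 : s.vol t r * s.src t r ≤ N t * s.srcRate E a t :=
      (mul_le_mul_of_nonneg_left h2 h4.le).trans (mul_le_mul_of_nonneg_right h3 h7)
    rw [← mul_div_assoc, div_le_iff₀ hν, mul_add]
    refine (add_le_add h9 h10).trans_eq ?_
    simp only [α, hc₁, hc₂]
    field_simp
    ring
  have hint : ∀ t ∈ Icc 0 T, N t ≤ B₂ * C₀ + ∫ τ in (0:ℝ)..t, α τ * N τ := by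
    intro t ht
    have : Nonempty (Icc (x t) R) := (nonempty_Icc.2 (hx.mem t ht).2.le).to_subtype
    refine ciSup_le fun r => ContinuousOn.le_of_le_Ico (hx.mem t ht).2 (cVx t ht)
      (fun r hr => ?_) r.2
    obtain ⟨z, hz₀, hzx, hzm, hzc, hzd⟩ := s.exists_outer_path hT hε hεR hh hxh ht hr
    have hv := sub_le_integral_of_deriv_le (α := fun τ => α τ * N τ)
      (continuousOn_comp_path cV hzc fun t ht => Ioo_subset_Icc_self (hzm t ht))
      (cα.mul cN) (fun τ hτ => s.hasDerivAt_vol hν.ne' hT hε hεR hzm hτ (hzd τ hτ))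
      (fun τ hτ => hrate τ (Ioo_subset_Icc_self hτ) _ (hzx τ (Ioo_subset_Icc_self hτ))) ht
    rw [hz₀] at hv
    refine hv.trans (add_le_add ?_ le_rfl)
    have hz0I := Ioo_subset_Icc_self (hzm 0 h0)
    have h1 := (hF 0 h0 (z 0) (hzx 0 h0)).2
    have h2 := (s.init_ρ (z 0) hz0I).1
    have h3 := s.ρ_pos 0 h0 _ hz0I
    rw [vol, div_eq_mul_inv]
    gcongr
    exact inv_le_of_inv_le₀ hC h2
  intro t ht r hr
  refine ((hle t ht r hr).trans (gronwall_integral cN cα hα0 hint ht)).trans ?_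
  gcongr
  have iS := cS.intervalIntegrable_sub h0 ht
  have iH := cH.intervalIntegrable_sub h0 ht
  simp only [α]
  rw [intervalIntegral.integral_add ((iS.div_const _).add (by simp)) (iH.const_mul _),
    intervalIntegral.integral_add (iS.div_const _) (by simp), intervalIntegral.integral_div,
    intervalIntegral.integral_const_mul, intervalIntegral.integral_const, smul_eq_mul, sub_zero]
  have h1 := s.integral_srcRate_le hM₀ hT hεR ha hE ht
  have h2 := hD t ht
  have h3 := ht.2
  gcongr

/-- Time integrability of the maximal temperature in an outer region. -/
lemma IsOuterRegion.integral_temperature_le {s : ApproxSol μ lam κ K ε R T C₀ M₀ Cf}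
    {x : ℝ → ℝ} (hx : s.IsOuterRegion x E a I) (hK : 0 < K) (hT : 0 < T) (hε : 0 < ε)
    (hεR : ε < R) (ha : 0 < a) (hE : 0 < E) {B m N D t : ℝ} (hB : 0 < B) (hm : 0 < m) (hN : 0 < N)
    (hmass : ∀ t ∈ Icc 0 T, ∫ r in x t..R, s.ρ t r * r = m)
    (hF : ∀ t ∈ Icc 0 T, ∀ r ∈ Icc (x t) R, B ≤ s.fac t r)
    (hV : ∀ t ∈ Icc 0 T, ∀ r ∈ Icc (x t) R, s.vol t r ≤ N)
    (hD : ∀ t ∈ Icc 0 T, ∫ τ in (0:ℝ)..t, s.heatDiss τ ≤ D) (ht : t ∈ Icc 0 T) :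
    ∫ τ in (0:ℝ)..t, (⨆ r : Icc (x τ) R, |s.θ τ r|) ≤
      T * (4 * E / m) + 2 * E / (B * a ^ 2) * N * D := by
  have h0 := left_mem_Icc.2 hT.le
  have cH := s.continuousOn_heatDiss hT hεR
  have iH := cH.intervalIntegrable_sub h0 ht
  have cS : ContinuousOn (fun τ => ⨆ r : Icc (x τ) R, |s.θ τ r|) (Icc 0 T) :=
    continuousOn_iSup_Icc (g := fun τ r => |s.θ τ r|) hT.le hεR.le s.continuousOn_θ.abs
      (fun t ht => Ioo_subset_Icc_self (hx.mem t ht)) hx.cont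
  have h1 := ContinuousOn.integral_mono_sub
    (g₂ := fun τ => 4 * E / m + 2 * E / (B * a ^ 2) * N * s.heatDiss τ) cS
    (continuousOn_const.add (continuousOn_const.mul cH)) le_rfl ht.1 ht.2 fun τ hτ => by
      have hτT : τ ∈ Icc 0 T := ⟨hτ.1, hτ.2.trans ht.2⟩
      have : Nonempty (Icc (x τ) R) := (nonempty_Icc.2 (hx.mem τ hτT).2.le).to_subtype
      refine ciSup_le fun r => ?_
      rw [abs_of_pos (s.θ_pos τ hτT r (hx.mem_of_mem_Icc hτT r.2).1)]
      exact hx.temperature_le_of_vol_le hK hT hε hεR ha hE hB hm hN hτT (hmass τ hτT) (hF τ hτT)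
        (hV τ hτT) r.2
  refine h1.trans ?_
  rw [intervalIntegral.integral_add (by simp) (iH.const_mul _), intervalIntegral.integral_const_mul,
    intervalIntegral.integral_const, smul_eq_mul, sub_zero]
  have h2 := hD t ht
  have h3 := ht.2
  gcongr

lemma isOuterRegion (s : ApproxSol μ lam κ K ε R T C₀ M₀ Cf) (hK : 0 < K) (hM₀ : 0 < M₀)
    (hT : 0 < T) (hε : 0 < ε) (hεR : ε < R) {x : ℝ → ℝ} {h : ℝ} (hh : 0 < h) (hhM : h < M₀)
    (hx : ∀ t ∈ Icc 0 T, x t ∈ Icc ε R ∧ ∫ r in ε..x t, s.ρ t r * r = h)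
    (hE : ∀ t ∈ Icc 0 T, (∫ r in ε..R, s.ent t r) + M₀ ≤ E) :
    s.IsOuterRegion x E (Real.sqrt (h * Real.exp (-(2 * E / (K * h) + 1))))
      ((M₀ - h) * Real.exp (-(2 * E / (K * (M₀ - h)) + 1))) where
  energy := hE
  mem _ ht := s.path_mem_Ioo hε hεR hx hT hh hhM ht
  cont := s.continuousOn_path hT hε hεR hx
  deriv _ ht := s.hasDerivAt_path hT hε hεR hx ht
  le_path t ht := by
    have hxt := (hx t ht).1
    have := s.mass_le_area hK hε hεR ht hM₀ (hE t ht) hh le_rfl hxt.1 hxt.2 (hx t ht).2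
    exact Real.sqrt_le_iff.2 ⟨hε.le.trans hxt.1, by linarith [sq_nonneg ε]⟩
  area t ht := by
    have hxt := (hx t ht).1
    exact s.mass_le_area hK hε hεR ht hM₀ (hE t ht) (sub_pos.2 hhM) hxt.1 hxt.2 le_rfl
      (s.integral_outer_mass hT hε hεR ht hxt (hx t ht).2)

end Bounds

end ApproxSol

/-- (Lemma 3.1: pointwise bounds away from the Lagrangian origin) Given `h ∈ (0,M₀)` and
`T > 0`, there is `C = C(T,h) > 0`, independent of `ε`, such that along the particle path
`r_h(t)` (defined by `∫_ε^{r_h(t)} ρ(t,r) r dr = h`) one has `C⁻¹ ≤ ρ ≤ C` on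
`[r_h(t), R]` for `t ∈ [0,T]`, and `∫_0^t sup_{[r_h(τ),R]} |θ(τ,·)| dτ ≤ C`. -/
theorem pointwise_bounds
    (μ lam κ K R T C₀ M₀ Cf h : ℝ)
    (hμ : 0 < μ) (hlam : 0 ≤ μ + lam) (hκ : 0 < κ) (hK : 0 < K)
    (hR : 0 < R) (hT : 0 < T) (hC₀ : 1 ≤ C₀) (hM₀ : 0 < M₀) (hCf : 0 < Cf)
    (hh : 0 < h) (hhM : h < M₀) :
    ∃ C : ℝ, 0 < C ∧ ∀ ε : ℝ, 0 < ε → ε < R →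
      ∀ s : ApproxSol μ lam κ K ε R T C₀ M₀ Cf,
      ∀ rh : ℝ → ℝ,
        (∀ t ∈ Icc (0:ℝ) T, rh t ∈ Icc ε R ∧ (∫ r in ε..(rh t), s.ρ t r * r) = h) →
        (∀ t ∈ Icc (0:ℝ) T, ∀ r ∈ Icc (rh t) R, C⁻¹ ≤ s.ρ t r ∧ s.ρ t r ≤ C) ∧
        (∀ t ∈ Icc (0:ℝ) T,
          (∫ τ in (0:ℝ)..t, (⨆ r : Icc (rh τ) R, |s.θ τ (r : ℝ)|)) ≤ C) := by
  have hν : 0 < lam + 2 * μ := by linarith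
  have hm : 0 < M₀ - h := sub_pos.2 hhM
  have hC : 0 < C₀ := zero_lt_one.trans_le hC₀
  set E := (C₀ + M₀) * Real.exp Cf with hEdef
  have hE : 0 < E := by positivity
  set a := Real.sqrt (h * Real.exp (-(2 * E / (K * h) + 1))) with hadef
  have ha : 0 < a := Real.sqrt_pos.2 (by positivity)
  set I := (M₀ - h) * Real.exp (-(2 * E / (K * (M₀ - h)) + 1)) with hIdef
  have hI : 0 < I := by positivity
  obtain ⟨B₁, hB₁, B₂, hB₂, hF⟩ := ApproxSol.exists_fac_bounds (κ := κ) (Cf := Cf)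
    hν hK hM₀ hT hC₀ hR ha hE hI
  obtain ⟨B₃, hB₃, hρ⟩ := ApproxSol.exists_density_le (κ := κ) (R := R) (Cf := Cf) (I := I)
    hν hK hM₀ hT hC₀ ha hE hB₁ hB₂ hh
  obtain ⟨B₄, hB₄, hV⟩ := ApproxSol.exists_vol_le (κ := κ) (R := R) (Cf := Cf) (I := I)
    (D := E / κ) hν hK hM₀ hT hC₀ ha hE hB₁ hB₂ hB₃ hh hhM
  set Θ := T * (4 * E / (M₀ - h)) + 2 * E / (B₁ * a ^ 2) * B₄ * (E / κ) with hΘdef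
  have hΘ : 0 < Θ := by positivity
  have hB₄₁ : 0 < B₄ / B₁ := by positivity
  refine ⟨B₃ + B₄ / B₁ + Θ, by positivity, ?_⟩
  intro ε hε hεR s x hxh
  have hent := fun t (ht : t ∈ Icc 0 T) =>
    s.entropy_estimate hμ hlam hK hκ hM₀ hC₀ hT hε hεR ht
  have hdiss : ∀ t ∈ Icc 0 T, ∫ τ in (0:ℝ)..t, s.heatDiss τ ≤ E / κ := fun t ht => by
    rw [le_div_iff₀' hκ]
    linarith [hent t ht, s.integral_ent_nonneg hK hε hεR ht]
  have hx := s.isOuterRegion hK hM₀ hT hε hεR hh hhM hxh (E := E) fun t ht => by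
    have : 0 ≤ κ * ∫ τ in (0:ℝ)..t, s.heatDiss τ := mul_nonneg hκ.le
      (intervalIntegral.integral_nonneg ht.1 fun τ _ => s.heatDiss_nonneg hε hεR τ)
    linarith [hent t ht]
  have hFs := hF ε hε hεR s x hx
  have hρs := hρ ε hε hεR s x hx hxh hFs
  have hVs := hV ε hε hεR s x hx hxh hFs hρs hdiss
  refine ⟨fun t ht r hr => ⟨?_, (hρs t ht r hr).trans (by linarith)⟩, fun t ht => ?_⟩
  · have h1 := s.ρ_pos t ht r (hx.mem_of_mem_Icc ht hr).1
    have h2 := (hFs t ht r hr).1.trans ((div_le_iff₀ h1).1 (hVs t ht r hr))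
    refine inv_le_of_inv_le₀ h1 (le_trans (b := B₄ / B₁) ?_ (by linarith))
    rwa [inv_le_iff_one_le_mul₀ h1, div_mul_eq_mul_div, one_le_div₀ hB₁]
  · refine (hx.integral_temperature_le hK hT hε hεR ha hE hB₁ hm hB₄
      (fun t ht => s.integral_outer_mass hT hε hεR ht (hxh t ht).1 (hxh t ht).2)
      (fun t ht r hr => (hFs t ht r hr).1) hVs hdiss ht).trans ?_
    linarith
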